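/- arXiv:0712.3637 — 2 statements merged into one kernel-verified Lean document; each statement's English description precedes it below -/
import Mathlib

section
/- If X and Y are spaces with cone-decompositions of lengths m and n respectively, then X × Y admits a cone-decomposition of length m + n; in particular Cat(X × Y) ≤ Cat(X) + Cat(Y). -/
/-!
STATEMENT 5: If X and Y admit cone-decompositions of lengths m and n respectively, then
X × Y admits a cone-decomposition of length m + n; in particular
Cat(X × Y) ≤ Cat(X) + Cat(Y).
-/

universe u

/-- The gluing relation for the mapping cone of `f : K → A`. -/
inductive ConeRel {K A : Type u} (f : K → A) :
    (K × unitInterval) ⊕ A → (K × unitInterval) ⊕ A → Prop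
  | glue (k : K) : ConeRel f (Sum.inl (k, 1)) (Sum.inr (f k))
  | apex (k k' : K) : ConeRel f (Sum.inl (k, 0)) (Sum.inl (k', 0))

/-- The mapping cone `A ∪_f CK` of `f : K → A`. -/
abbrev MappingCone {K A : Type u} (f : K → A) : Type u := Quot (ConeRel f)

/-- A cone-decomposition of `X` of length `m`: a sequence of cofibrations
`K_i → F_{i-1} ↪ F_i` with `F_0 = *` and `F_m ≃ X`.  Its existence says `Cat(X) ≤ m`. -/
structure ConeDecomp (X : Type u) [TopologicalSpace X] (m : ℕ) where
  /-- The filtration spaces `F_0, …, F_m`. -/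
  F : Fin (m + 1) → TopCat.{u}
  /-- The attaching spaces `K_1, …, K_m`. -/
  K : Fin m → TopCat.{u}
  /-- The attaching maps `h_i : K_i → F_{i-1}`. -/
  h : ∀ i : Fin m, C(K i, F i.castSucc)
  /-- `F_0` is a one-point space. -/
  F0 : Unique (F 0)
  /-- Each `F_i` is the mapping cone of `h_i`. -/
  cone : ∀ i : Fin m, F i.succ ≃ₜ MappingCone ⇑(h i)
  /-- `F_m` has the homotopy type of `X`. -/
  equiv : ContinuousMap.HomotopyEquiv (F (Fin.last m)) X

open Set Topology ContinuousMap

section Homotopy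

variable {X Y : Type*} [TopologicalSpace X] [TopologicalSpace Y]

theorem ContinuousMap.Homotopic.of_unitInterval {f g : C(X, Y)} (H : C(X × unitInterval, Y))
    (h0 : ∀ x, H (x, 0) = f x) (h1 : ∀ x, H (x, 1) = g x) : f.Homotopic g :=
  ⟨{ toFun := fun p => H (p.2, p.1)
     map_zero_left := by simpa using h0
     map_one_left := by simpa using h1 }⟩

/-- A homotopy extended to all real values of its parameter. -/
theorem ContinuousMap.Homotopic.exists_real {f g : C(X, Y)} (h : f.Homotopic g) :
    ∃ H : C(X × ℝ, Y), (∀ x, ∀ s ≤ 0, H (x, s) = f x) ∧ ∀ x, ∀ s, 1 ≤ s → H (x, s) = g x := by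
  obtain ⟨F⟩ := h
  refine ⟨⟨fun p => F (projIcc 0 1 zero_le_one p.2, p.1),
    F.continuous.comp ((continuous_projIcc.comp continuous_snd).prodMk continuous_fst)⟩,
    fun x s hs => ?_, fun x s hs => ?_⟩
  · exact (congrArg (fun t => F (t, x)) (projIcc_of_le_left _ hs)).trans (F.apply_zero x)
  · exact (congrArg (fun t => F (t, x)) (projIcc_of_right_le _ hs)).trans (F.apply_one x)

theorem ContractibleSpace.exists_contraction (X : Type*) [TopologicalSpace X]
    [ContractibleSpace X] :
    ∃ (c : X) (H : C(X × ℝ, X)), (∀ x, ∀ s ≤ 0, H (x, s) = x) ∧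
      ∀ x, ∀ s, 1 ≤ s → H (x, s) = c := by
  obtain ⟨c, hc⟩ := id_nullhomotopic X
  obtain ⟨H, h0, h1⟩ := hc.exists_real
  exact ⟨c, H, h0, h1⟩

end Homotopy

namespace MappingCone

variable {K A : Type u}

/-- The inclusion of the base in a mapping cone. -/
def base (f : K → A) (a : A) : MappingCone f := Quot.mk _ (Sum.inr a)

/-- The point at height `r` over `k`, with `r` clamped to the unit interval. -/
noncomputable def seg (f : K → A) (k : K) (r : ℝ) : MappingCone f :=
  Quot.mk _ (Sum.inl (k, projIcc 0 1 zero_le_one r))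

theorem seg_of_one_le (f : K → A) (k : K) {r : ℝ} (hr : 1 ≤ r) : seg f k r = base f (f k) := by
  rw [seg, projIcc_of_right_le _ hr]
  exact Quot.sound (ConeRel.glue k)

theorem seg_of_nonpos (f : K → A) (k k' : K) {r r' : ℝ} (hr : r ≤ 0) (hr' : r' ≤ 0) :
    seg f k r = seg f k' r' := by
  rw [seg, seg, projIcc_of_le_left _ hr, projIcc_of_le_left _ hr']
  exact Quot.sound (ConeRel.apex k k')

theorem ind {f : K → A} {P : MappingCone f → Prop} (hb : ∀ a, P (base f a))
    (hs : ∀ k, ∀ t ∈ Icc (0 : ℝ) 1, P (seg f k t)) (x : MappingCone f) : P x := by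
  induction x using Quot.ind with
  | mk x =>
    rcases x with ⟨k, t⟩ | a
    · have := hs k t t.2
      rwa [seg, projIcc_of_mem _ t.2] at this
    · exact hb a

variable [TopologicalSpace K] [TopologicalSpace A] {T : Type*} [TopologicalSpace T]

@[fun_prop]
theorem continuous_base (f : K → A) : Continuous (base f) :=
  continuous_quot_mk.comp continuous_inr

@[fun_prop]
theorem continuous_seg (f : K → A) {Q : Type*} [TopologicalSpace Q] {k : Q → K} {r : Q → ℝ}
    (hk : Continuous k) (hr : Continuous r) : Continuous fun q => seg f (k q) (r q) :=
  continuous_quot_mk.comp (continuous_inl.comp (hk.prodMk (continuous_projIcc.comp hr)))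

/-- Maps out of a mapping cone. -/
theorem exists_desc (f : K → A) (u : C(A, T)) (n : C(K × ℝ, T))
    (h1 : ∀ k, n (k, 1) = u (f k)) (h0 : ∀ k k', n (k, 0) = n (k', 0)) :
    ∃ Φ : C(MappingCone f, T), (∀ a, Φ (base f a) = u a) ∧
      ∀ k, ∀ t ∈ Icc (0 : ℝ) 1, Φ (seg f k t) = n (k, t) := by
  refine ⟨⟨Quot.lift (Sum.elim (fun p => n (p.1, (p.2 : ℝ))) u) ?_, ?_⟩, fun a => rfl, ?_⟩
  · rintro _ _ (k | ⟨k, k'⟩)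
    · simpa using h1 k
    · simpa using h0 k k'
  · exact continuous_quot_lift _ (by fun_prop)
  · intro k t ht
    change n (k, ((projIcc 0 1 zero_le_one t : unitInterval) : ℝ)) = _
    rw [projIcc_of_mem _ ht]

/-- Homotopies on a mapping cone. -/
theorem exists_desc_homotopy (f : K → A) (u : C(A × ℝ, T)) (n : C(K × ℝ × ℝ, T))
    (h1 : ∀ k, ∀ v ∈ Icc (0 : ℝ) 1, n (k, 1, v) = u (f k, v))
    (h0 : ∀ k k', ∀ v ∈ Icc (0 : ℝ) 1, n (k, 0, v) = n (k', 0, v)) :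
    ∃ G : C(MappingCone f × unitInterval, T), (∀ a v, G (base f a, v) = u (a, v)) ∧
      ∀ k, ∀ t ∈ Icc (0 : ℝ) 1, ∀ v, G (seg f k t, v) = n (k, t, v) := by
  let u' : C(A, C(unitInterval, T)) :=
    ContinuousMap.curry ⟨fun p : A × unitInterval => u (p.1, p.2), by fun_prop⟩
  let n' : C(K × ℝ, C(unitInterval, T)) :=
    ContinuousMap.curry ⟨fun p : (K × ℝ) × unitInterval => n (p.1.1, p.1.2, p.2), by fun_prop⟩
  obtain ⟨Θ, hb, hs⟩ := exists_desc f u' n' (fun k => by ext v; exact h1 k v v.2)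
    (fun k k' => by ext v; exact h0 k k' v v.2)
  refine ⟨⟨fun p => Θ p.1 p.2, continuous_uncurry_of_continuous Θ⟩, fun a v => ?_,
    fun k t ht v => ?_⟩
  · exact congrArg (fun g : C(unitInterval, T) => g v) (hb a)
  · exact congrArg (fun g : C(unitInterval, T) => g v) (hs k t ht)

/-- Homotopies between maps out of a mapping cone. -/
theorem homotopic_of (f : K → A) {Φ Ψ : C(MappingCone f, T)} (u : C(A × ℝ, T))
    (n : C(K × ℝ × ℝ, T)) (h1 : ∀ k, ∀ v ∈ Icc (0 : ℝ) 1, n (k, 1, v) = u (f k, v))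
    (h0 : ∀ k k', ∀ v ∈ Icc (0 : ℝ) 1, n (k, 0, v) = n (k', 0, v))
    (hΦb : ∀ a, Φ (base f a) = u (a, 0)) (hΨb : ∀ a, Ψ (base f a) = u (a, 1))
    (hΦs : ∀ k, ∀ t ∈ Icc (0 : ℝ) 1, Φ (seg f k t) = n (k, t, 0))
    (hΨs : ∀ k, ∀ t ∈ Icc (0 : ℝ) 1, Ψ (seg f k t) = n (k, t, 1)) : Φ.Homotopic Ψ := by
  obtain ⟨G, hb, hs⟩ := exists_desc_homotopy f u n h1 h0
  refine Homotopic.of_unitInterval G (ind (fun a => ?_) fun k t ht => ?_)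
    (ind (fun a => ?_) fun k t ht => ?_)
  · simp [hb, hΦb]
  · simp [hs k t ht, hΦs k t ht]
  · simp [hb, hΨb]
  · simp [hs k t ht, hΨs k t ht]

/-- A path that first runs through the cone and then continues in the base is continuous. -/
theorem continuous_glue (f : K → A) {Q : Type*} [TopologicalSpace Q] {k : Q → K} {r s : Q → ℝ}
    {b : Q → A} (hk : Continuous k) (hr : Continuous r) (hb : Continuous b) (hs : Continuous s)
    (h : ∀ q, s q = 1 → 1 ≤ r q ∧ f (k q) = b q) :
    Continuous fun q => if s q ≤ 1 then seg f (k q) (r q) else base f (b q) := by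
  refine Continuous.if_le (by fun_prop) (by fun_prop) hs continuous_const fun q hq => ?_
  rw [seg_of_one_le f _ (h q hq).1, (h q hq).2]

variable {B : Type u} [TopologicalSpace B]

/-- `Φ` is induced by `e : A → B` together with a homotopy from `e ∘ f` to `f'`. -/
def IsInduced (f : C(K, A)) (f' : C(K, B)) (e : C(A, B))
    (Φ : C(MappingCone f, MappingCone f')) : Prop :=
  ∃ h : C(K × ℝ, B), (∀ k, h (k, 0) = e (f k)) ∧ (∀ k, h (k, 1) = f' k) ∧
    (∀ a, Φ (base f a) = base f' (e a)) ∧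
    ∀ k, ∀ t ∈ Icc (0 : ℝ) 1, Φ (seg f k t) =
      if 2 * t ≤ 1 then seg f' k (2 * t) else base f' (h (k, 2 - 2 * t))

theorem exists_isInduced (f : C(K, A)) (f' : C(K, B)) (e : C(A, B)) (h : C(K × ℝ, B))
    (h0 : ∀ k, h (k, 0) = e (f k)) (h1 : ∀ k, h (k, 1) = f' k) :
    ∃ Φ : C(MappingCone f, MappingCone f'),
      (∀ a, Φ (base f a) = base f' (e a)) ∧ ∀ k, ∀ t ∈ Icc (0 : ℝ) 1, Φ (seg f k t) =
      if 2 * t ≤ 1 then seg f' k (2 * t) else base f' (h (k, 2 - 2 * t)) := by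
  refine exists_desc f ⟨fun a => base f' (e a), by fun_prop⟩
    ⟨fun p => if 2 * p.2 ≤ 1 then seg f' p.1 (2 * p.2) else base f' (h (p.1, 2 - 2 * p.2)),
      continuous_glue f' (by fun_prop) (by fun_prop) (by fun_prop) (by fun_prop) ?_⟩ ?_ ?_
  · intro q hq
    exact ⟨hq.ge, by rw [show 2 - 2 * q.2 = 1 by linarith, h1]⟩
  · intro k
    simp [h0]
  · intro k k'
    simpa using seg_of_nonpos _ k k' le_rfl le_rfl

theorem IsInduced.exists_leftInv {f : C(K, A)} {f' : C(K, B)} {e : C(A, B)}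
    {Φ : C(MappingCone f, MappingCone f')} (hΦ : IsInduced f f' e Φ) {g : C(B, A)}
    (hg : (g.comp e).Homotopic (ContinuousMap.id A)) :
    ∃ Ψ, IsInduced f' f g Ψ ∧ (Ψ.comp Φ).Homotopic (ContinuousMap.id _) := by
  obtain ⟨h, h0, h1, hΦb, hΦs⟩ := hΦ
  obtain ⟨α, α0, α1⟩ := hg.exists_real
  simp only [comp_apply, id_apply] at α0 α1
  let h' : C(K × ℝ, A) :=
    ⟨fun p => if p.2 ≤ 1 / 2 then g (h (p.1, 1 - 2 * p.2)) else α (f p.1, 2 * p.2 - 1), by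
      refine Continuous.if_le (by fun_prop) (by fun_prop) (by fun_prop) (by fun_prop) ?_
      intro p hp
      rw [hp, α0 _ _ (by norm_num), ← h0]
      norm_num⟩
  have h'0 : ∀ k, h' (k, 0) = g (f' k) := fun k => by simp [h', h1]
  have h'1 : ∀ k, h' (k, 1) = f k := fun k => by
    have : ¬ (1 : ℝ) ≤ 1 / 2 := by norm_num
    simp only [h', coe_mk, if_neg this]
    exact α1 _ _ (by norm_num)
  obtain ⟨Ψ, hΨb, hΨs⟩ := exists_isInduced f' f g h' h'0 h'1
  refine ⟨Ψ, ⟨h', h'0, h'1, hΨb, hΨs⟩, ?_⟩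
  -- the part of the path inside `A`
  let b : C(K × ℝ × ℝ, A) :=
    ⟨fun p => if p.2.1 ≤ 3 / 8 then α (f p.1, 3 - 8 * p.2.1) else
        g (h (p.1, (1 - p.2.2) * min (8 * p.2.1 - 3) (2 - 2 * p.2.1))), by
      refine Continuous.if_le (by fun_prop) (by fun_prop) (by fun_prop) (by fun_prop) ?_
      rintro ⟨k, t, v⟩ (rfl : t = 3 / 8)
      rw [α0 _ _ (by norm_num), ← h0]
      norm_num⟩
  let n₁ : C(K × ℝ × ℝ, MappingCone f) :=
    ⟨fun p => if 4 * p.2.1 ≤ 1 then seg f p.1 (4 * p.2.1) else base f (b p), by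
      refine continuous_glue f (by fun_prop) (by fun_prop) (by fun_prop) (by fun_prop) ?_
      rintro ⟨k, t, v⟩ (ht : 4 * t = 1)
      obtain rfl : t = 1 / 4 := by linarith
      refine ⟨by norm_num, ?_⟩
      have : (1 / 4 : ℝ) ≤ 3 / 8 := by norm_num
      simp only [b, coe_mk, if_pos this]
      rw [α1 _ _ (by norm_num)]⟩
  let n₂ : C(K × ℝ × ℝ, MappingCone f) :=
    ⟨fun p => if 4 * p.2.1 ≤ 1 then seg f p.1 (4 * p.2.1) else
        base f (α (f p.1, max (3 - 8 * p.2.1) p.2.2)), by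
      refine continuous_glue f (by fun_prop) (by fun_prop) (by fun_prop) (by fun_prop) ?_
      rintro ⟨k, t, v⟩ (ht : 4 * t = 1)
      obtain rfl : t = 1 / 4 := by linarith
      refine ⟨by norm_num, ?_⟩
      rw [α1 _ _ (le_max_of_le_left (by norm_num))]⟩
  let n₃ : C(K × ℝ × ℝ, MappingCone f) :=
    ⟨fun p => seg f p.1 ((1 - p.2.2) * (4 * p.2.1) + p.2.2 * p.2.1), by fun_prop⟩
  let u₁ : C(A × ℝ, MappingCone f) := ⟨fun p => base f (g (e p.1)), by fun_prop⟩
  let u₂ : C(A × ℝ, MappingCone f) := ⟨fun p => base f (α p), by fun_prop⟩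
  let u₃ : C(A × ℝ, MappingCone f) := ⟨fun p => base f p.1, by fun_prop⟩
  have apex : ∀ k k', seg f k 0 = seg f k' 0 := fun k k' => seg_of_nonpos _ k k' le_rfl le_rfl
  have n41 : ¬ (4 : ℝ) ≤ 1 := by norm_num
  have n138 : ¬ (1 : ℝ) ≤ 3 / 8 := by norm_num
  have h₂1 : ∀ k, ∀ v ∈ Icc (0 : ℝ) 1, n₂ (k, 1, v) = u₂ (f k, v) := fun k v hv => by
    have : max (3 - 8) v = v := max_eq_right (by linarith [hv.1])
    simp only [n₂, u₂, coe_mk, mul_one, if_neg n41, this]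
  have h₃1 : ∀ k, ∀ v ∈ Icc (0 : ℝ) 1, n₃ (k, 1, v) = u₃ (f k, v) := fun k v hv =>
    seg_of_one_le f k (by dsimp only; nlinarith [hv.1, hv.2])
  obtain ⟨Θ₁, hΘ₁b, hΘ₁s⟩ := exists_desc f ⟨fun a => u₂ (a, 0), by fun_prop⟩
    ⟨fun p => n₂ (p.1, p.2, 0), by fun_prop⟩ (fun k => h₂1 k 0 (by simp))
    (fun k k' => by simpa [n₂] using apex k k')
  obtain ⟨Θ₂, hΘ₂b, hΘ₂s⟩ := exists_desc f ⟨fun a => u₃ (a, 0), by fun_prop⟩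
    ⟨fun p => n₃ (p.1, p.2, 0), by fun_prop⟩ (fun k => h₃1 k 0 (by simp))
    (fun k k' => by simpa [n₃] using apex k k')
  have H₁ : (Ψ.comp Φ).Homotopic Θ₁ := by
    refine homotopic_of f u₁ n₁ ?_ ?_ ?_ ?_ ?_ ?_
    · intro k v hv
      have : min (8 - 3) (2 - 2) = (0 : ℝ) := by norm_num
      simp only [n₁, u₁, b, coe_mk, mul_one, if_neg n41, if_neg n138, this, mul_zero, h0]
    · intro k k' v hv
      simpa [n₁] using apex k k'
    · intro a
      simp [u₁, hΦb, hΨb]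
    · intro a
      simp [u₁, hΘ₁b, u₂, α0]
    · intro k t ht
      rw [comp_apply, hΦs k t ht]
      by_cases h2 : 2 * t ≤ 1
      · rw [if_pos h2, hΨs k _ ⟨by linarith [ht.1], h2⟩]
        by_cases h4 : 4 * t ≤ 1
        · have h4' : 2 * (2 * t) ≤ 1 := by linarith
          simp only [n₁, coe_mk, if_pos h4, if_pos h4']
          congr 1; ring
        · have h4' : ¬ 2 * (2 * t) ≤ 1 := by linarith
          simp only [n₁, coe_mk, if_neg h4, if_neg h4', h', b]
          by_cases h8 : t ≤ 3 / 8
          · rw [if_pos h8]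
            rcases h8.eq_or_lt with rfl | h8'
            · have : (2 - 2 * (2 * (3 / 8)) : ℝ) ≤ 1 / 2 := by norm_num
              rw [if_pos this, α0 _ _ (by norm_num), ← h0]
              norm_num
            · have : ¬ 2 - 2 * (2 * t) ≤ 1 / 2 := by linarith
              rw [if_neg this]
              congr 3; ring
          · have : 2 - 2 * (2 * t) ≤ 1 / 2 := by linarith
            rw [if_neg h8, if_pos this, min_eq_left (by linarith)]
            congr 4; ring
      · have h4 : ¬ 4 * t ≤ 1 := by linarith
        have h8 : ¬ t ≤ 3 / 8 := by linarith
        rw [if_neg h2, hΨb]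
        simp only [n₁, coe_mk, if_neg h4, b, if_neg h8]
        rw [min_eq_right (by linarith)]
        simp
    · intro k t ht
      rw [hΘ₁s k t ht]
      simp only [n₁, n₂, b, coe_mk]
      by_cases h4 : 4 * t ≤ 1
      · simp only [if_pos h4]
      · simp only [if_neg h4]
        by_cases h8 : t ≤ 3 / 8
        · rw [if_pos h8, max_eq_left (by linarith)]
        · rw [if_neg h8, max_eq_right (by linarith), α0 _ _ le_rfl, ← h0]
          simp
  have H₂ : Θ₁.Homotopic Θ₂ := by
    refine homotopic_of f u₂ n₂ h₂1 ?_ hΘ₁b ?_ hΘ₁s ?_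
    · intro k k' v hv
      simpa [n₂] using apex k k'
    · intro a
      simp [hΘ₂b, u₂, u₃, α1]
    · intro k t ht
      rw [hΘ₂s k t ht]
      simp only [n₂, n₃, coe_mk]
      by_cases h4 : 4 * t ≤ 1
      · rw [if_pos h4]; congr 1; ring
      · rw [if_neg h4, α1 _ _ (le_max_right _ _), seg_of_one_le f k (by linarith)]
  have H₃ : Θ₂.Homotopic (ContinuousMap.id _) := by
    refine homotopic_of f u₃ n₃ h₃1 ?_ hΘ₂b ?_ hΘ₂s ?_
    · intro k k' v hv
      simpa [n₃] using apex k k'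
    · intro a
      simp [u₃]
    · intro k t ht
      simp [n₃]
  exact (H₁.trans H₂).trans H₃

/-- The homotopy type of a mapping cone depends only on the homotopy type of the base. -/
theorem nonempty_homotopyEquiv_comp (f : C(K, A)) (e : A ≃ₕ B) :
    Nonempty (MappingCone f ≃ₕ MappingCone (e.toFun.comp f)) := by
  obtain ⟨Φ, hb, hs⟩ := exists_isInduced f (e.toFun.comp f) e.toFun
    ⟨fun p => e.toFun (f p.1), by fun_prop⟩ (fun k => rfl) (fun k => rfl)
  obtain ⟨L, hL, hLΦ⟩ := IsInduced.exists_leftInv ⟨_, fun k => rfl, fun k => rfl, hb, hs⟩ e.left_inv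
  obtain ⟨M, -, hML⟩ := hL.exists_leftInv e.right_inv
  refine ⟨⟨Φ, L, hLΦ, ?_⟩⟩
  have : Φ.Homotopic M := by
    have h1 : ((M.comp L).comp Φ).Homotopic Φ := Homotopic.comp hML (.refl Φ)
    have h2 : (M.comp (L.comp Φ)).Homotopic M := Homotopic.comp (.refl M) hLΦ
    exact h1.symm.trans h2
  exact (Homotopic.comp this (.refl L)).trans hML

end MappingCone
theorem continuous_of_isOpen_iUnion {κ Q T : Type*} [TopologicalSpace Q] [TopologicalSpace T]
    {F : Q → T} {P : κ → Set Q} (hP : ∀ i, IsOpen (P i)) (hc : ∀ q, ∃ i, q ∈ P i)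
    (h : ∀ i, ∃ g : P i → T, Continuous g ∧ ∀ q : P i, F q = g q) : Continuous F := by
  refine continuous_of_cover_nhds (s := P) (fun q => ?_) fun i => ?_
  · obtain ⟨i, hi⟩ := hc q
    exact ⟨i, (hP i).mem_nhds hi⟩
  · obtain ⟨g, hg, hFg⟩ := h i
    rw [continuousOn_iff_continuous_domRestrict]
    exact hg.congr fun q => (hFg q).symm

theorem continuous_of_isOpen_union {Q T : Type*} [TopologicalSpace Q] [TopologicalSpace T]
    {F : Q → T} {P R : Set Q} (hP : IsOpen P) (hR : IsOpen R) (hc : ∀ q, q ∈ P ∨ q ∈ R)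
    {a : P → T} {b : R → T} (ha : Continuous a) (hb : Continuous b) (hFa : ∀ q : P, F q = a q)
    (hFb : ∀ q : R, F q = b q) : Continuous F :=
  continuous_of_isOpen_iUnion (P := fun i : Bool => cond i P R) (by simp [hP, hR])
    (by simpa [or_comm] using hc) (Bool.forall_bool.2 ⟨⟨b, hb, hFb⟩, ⟨a, ha, hFa⟩⟩)

section Recognition

open MappingCone

variable {Z : Type u} [TopologicalSpace Z]

/-- The inclusion of the overlap of `{τ < 1}` and `{0 < τ}` in the latter. -/
def overlapInclusion (τ : C(Z, ℝ)) : C({z // 0 < τ z ∧ τ z < 1}, {z // 0 < τ z}) :=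
  ⟨fun z => ⟨z, z.2.1⟩, by fun_prop⟩

/-- If `{τ < 1}` is contractible, then `Z` is obtained up to homotopy from `{0 < τ}` by attaching
a cone on the overlap of the two sets. -/
theorem nonempty_homotopyEquiv_overlapInclusion (τ : C(Z, ℝ)) [ContractibleSpace {z // τ z < 1}]
    (hne : ∃ z, 0 < τ z ∧ τ z < 1) : Nonempty (Z ≃ₕ MappingCone (overlapInclusion τ)) := by
  classical
  obtain ⟨z₀, hz₀⟩ := hne
  obtain ⟨c₀, H, H0, H1⟩ := ContractibleSpace.exists_contraction {z // τ z < 1}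
  let f := overlapInclusion τ
  let k₀ : {z // 0 < τ z ∧ τ z < 1} := ⟨z₀, hz₀⟩
  let c : C(Z, ℝ) := ⟨fun z => max 0 (min 1 (3 * τ z - 1)), by fun_prop⟩
  have hc0 : ∀ z, 0 ≤ c z := fun z => le_max_left _ _
  have hc1 : ∀ z, c z ≤ 1 := fun z => max_le zero_le_one (min_le_left _ _)
  have hcl : ∀ z, τ z ≤ 1 / 3 → c z = 0 := fun z hz =>
    max_eq_left ((min_le_right _ _).trans (by linarith))
  have hch : ∀ z, 2 / 3 ≤ τ z → c z = 1 := fun z hz => by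
    simp only [c, ContinuousMap.coe_mk]
    rw [min_eq_left (by linarith)]
    simp
  -- the part of the map `Z → MappingCone f` on `{τ < 1}`, pushed towards the apex
  let L : C({z // τ z < 1} × ℝ, MappingCone f) :=
    ⟨fun p => if h : 0 < τ p.1 then seg f ⟨p.1, h, p.1.2⟩ ((1 - p.2) * c p.1) else seg f k₀ 0, by
      refine continuous_of_isOpen_union (P := {p | 0 < τ p.1}) (R := {p | τ p.1 < 1 / 3})
        (a := fun p => seg f ⟨p.1.1, p.2, p.1.1.2⟩ ((1 - p.1.2) * c p.1.1))
        (b := fun p => seg f k₀ 0) (isOpen_lt (by fun_prop) (by fun_prop))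
        (isOpen_lt (by fun_prop) (by fun_prop)) ?_ (by fun_prop) (by fun_prop) ?_ ?_
      · intro p
        rcases lt_or_ge 0 (τ p.1) with h | h
        · exact Or.inl h
        · exact Or.inr (lt_of_le_of_lt h (by norm_num))
      · intro p
        exact dif_pos p.2
      · intro p
        by_cases h : 0 < τ p.1.1
        · rw [dif_pos h, hcl _ (le_of_lt p.2), mul_zero]
          exact seg_of_nonpos _ _ _ le_rfl le_rfl
        · rw [dif_neg h]⟩
  have hL1 : ∀ z, L (z, 1) = seg f k₀ 0 := fun z => by
    by_cases h : 0 < τ z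
    · simp only [L, ContinuousMap.coe_mk, dif_pos h]
      exact seg_of_nonpos _ _ _ (by simp) le_rfl
    · simp only [L, ContinuousMap.coe_mk, dif_neg h]
  let φ : C(Z, MappingCone f) :=
    ⟨fun z => if h : τ z < 1 then L (⟨z, h⟩, 0) else
        if h' : 0 < τ z then base f ⟨z, h'⟩ else seg f k₀ 0, by
      refine continuous_of_isOpen_union (P := {z | τ z < 1}) (R := {z | 2 / 3 < τ z})
        (a := fun z => L (z, 0))
        (b := fun z => base f ⟨z, lt_trans (by norm_num) z.2⟩)
        (isOpen_lt (by fun_prop) (by fun_prop))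
        (isOpen_lt (by fun_prop) (by fun_prop)) ?_ (by fun_prop) (by fun_prop) ?_ ?_
      · intro z
        rcases lt_or_ge (τ z) 1 with h | h
        · exact Or.inl h
        · exact Or.inr (lt_of_lt_of_le (by norm_num) h)
      · intro z
        exact dif_pos z.2
      · intro z
        have h' : 0 < τ z := lt_trans (by norm_num) z.2
        by_cases h : τ z < 1
        · simp only [dif_pos h, L, ContinuousMap.coe_mk, dif_pos h', hch _ (le_of_lt z.2)]
          rw [seg_of_one_le _ _ (by simp)]
          rfl
        · rw [dif_neg h, dif_pos h']⟩
  have hφ : ∀ z (h : τ z < 1), φ z = L (⟨z, h⟩, 0) := fun z h => dif_pos h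
  obtain ⟨ψ, hψb, hψs⟩ := exists_desc f (T := Z) ⟨fun z => z, by fun_prop⟩
    ⟨fun p => H (⟨p.1, p.1.2.2⟩, 1 - p.2), by fun_prop⟩
    (fun k => by simp [H0, f, overlapInclusion]) (fun k k' => by simp [H1])
  refine ⟨⟨φ, ψ, ?_, ?_⟩⟩
  · refine Homotopic.symm (Homotopic.of_unitInterval
      ⟨fun p => if h : τ p.1 < 1 then (H (⟨p.1, h⟩, (p.2 : ℝ) * (1 - c p.1))).1 else p.1, ?_⟩ ?_ ?_)
    · refine continuous_of_isOpen_union (P := {p | τ p.1 < 1}) (R := {p | 2 / 3 < τ p.1})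
        (a := fun p => (H (⟨p.1.1, p.2⟩, (p.1.2 : ℝ) * (1 - c p.1.1))).1) (b := fun p => p.1.1)
        (isOpen_lt (by fun_prop) (by fun_prop))
        (isOpen_lt (by fun_prop) (by fun_prop)) ?_ (by fun_prop) (by fun_prop) ?_ ?_
      · intro p
        rcases lt_or_ge (τ p.1) 1 with h | h
        · exact Or.inl h
        · exact Or.inr (lt_of_lt_of_le (by norm_num) h)
      · intro p
        exact dif_pos p.2
      · intro p
        by_cases h : τ p.1.1 < 1
        · rw [dif_pos h, H0 _ _ (by rw [hch _ (le_of_lt p.2)]; simp)]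
        · rw [dif_neg h]
    · intro z
      by_cases h : τ z < 1
      · simp [h, H0]
      · simp [h]
    · intro z
      by_cases h : τ z < 1
      · by_cases h' : 0 < τ z
        · simp only [ContinuousMap.coe_mk, dif_pos h, ContinuousMap.comp_apply, hφ _ h, L,
            dif_pos h']
          rw [hψs _ _ (by simp [hc0, hc1])]
          simp
        · simp only [ContinuousMap.coe_mk, dif_pos h, ContinuousMap.comp_apply, hφ _ h, L,
            dif_neg h']
          rw [hψs _ _ (by simp), H1 _ _ (by rw [hcl _ (by linarith)]; simp)]
          simp [H1]
      · have h' : 0 < τ z := by linarith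
        simp [h, φ, h', hψb]
  · let u₁ : C({z // 0 < τ z} × ℝ, MappingCone f) :=
      ⟨fun p => if h : τ p.1 < 1 then seg f ⟨p.1, p.1.2, h⟩ (1 - p.2 + p.2 * c p.1) else
          base f p.1, by
        refine continuous_of_isOpen_union (P := {p | τ p.1 < 1}) (R := {p | 2 / 3 < τ p.1})
          (a := fun p => seg f ⟨p.1.1, p.1.1.2, p.2⟩ (1 - p.1.2 + p.1.2 * c p.1.1))
          (b := fun p => base f p.1.1) (isOpen_lt (by fun_prop) (by fun_prop))
          (isOpen_lt (by fun_prop) (by fun_prop)) ?_ (by fun_prop) (by fun_prop) ?_ ?_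
        · intro p
          rcases lt_or_ge (τ p.1) 1 with h | h
          · exact Or.inl h
          · exact Or.inr (lt_of_lt_of_le (by norm_num) h)
        · intro p
          exact dif_pos p.2
        · intro p
          by_cases h : τ p.1.1 < 1
          · rw [dif_pos h, hch _ (le_of_lt p.2), seg_of_one_le _ _ (by simp)]
            rfl
          · rw [dif_neg h]⟩
    let n₁ : C({z // 0 < τ z ∧ τ z < 1} × ℝ × ℝ, MappingCone f) :=
      ⟨fun p => seg f p.1 (p.2.1 * (1 - p.2.2 + p.2.2 * c p.1)), by fun_prop⟩
    let n₂ : C({z // 0 < τ z ∧ τ z < 1} × ℝ × ℝ, MappingCone f) :=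
      ⟨fun p => L (H (⟨p.1, p.1.2.2⟩, p.2.2 * (1 - p.2.1)), 1 - p.2.1), by fun_prop⟩
    let n₃ : C({z // 0 < τ z ∧ τ z < 1} × ℝ × ℝ, MappingCone f) :=
      ⟨fun p => L (H (⟨p.1, p.1.2.2⟩, 1 - p.2.1), (1 - p.2.2) * (1 - p.2.1)), by fun_prop⟩
    let u₂ : C({z // 0 < τ z} × ℝ, MappingCone f) := ⟨fun p => φ p.1, by fun_prop⟩
    have h₂1 : ∀ k, ∀ v ∈ Icc (0 : ℝ) 1, n₂ (k, 1, v) = u₂ (f k, v) := fun k v hv => by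
      simp only [n₂, u₂, ContinuousMap.coe_mk, sub_self, mul_zero]
      rw [H0 _ _ le_rfl]
      exact (hφ _ _).symm
    have h₃1 : ∀ k, ∀ v ∈ Icc (0 : ℝ) 1, n₃ (k, 1, v) = u₂ (f k, v) := fun k v hv => by
      simp only [n₃, u₂, ContinuousMap.coe_mk, sub_self, mul_zero]
      rw [H0 _ _ le_rfl]
      exact (hφ _ _).symm
    obtain ⟨Θ₁, hΘ₁b, hΘ₁s⟩ := exists_desc f ⟨fun a => u₂ (a, 0), by fun_prop⟩
      ⟨fun p => n₂ (p.1, p.2, 0), by fun_prop⟩ (fun k => h₂1 k 0 (by simp))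
      (fun k k' => by simp [n₂, hL1])
    obtain ⟨Θ₂, hΘ₂b, hΘ₂s⟩ := exists_desc f ⟨fun a => u₂ (a, 0), by fun_prop⟩
      ⟨fun p => n₃ (p.1, p.2, 0), by fun_prop⟩ (fun k => h₃1 k 0 (by simp))
      (fun k k' => by simp [n₃, hL1])
    have E₁ : (ContinuousMap.id _).Homotopic Θ₁ := by
      refine homotopic_of f u₁ n₁ ?_ ?_ ?_ ?_ ?_ ?_
      · intro k v hv
        refine Eq.trans ?_ (dif_pos (show τ (f k).1 < 1 from k.2.2)).symm
        simp only [n₁, ContinuousMap.coe_mk, one_mul]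
        rfl
      · intro k k' v hv
        exact seg_of_nonpos _ _ _ (by simp) (by simp)
      · intro a
        by_cases h : τ a < 1
        · simp only [u₁, ContinuousMap.coe_mk, dif_pos h]
          rw [seg_of_one_le _ _ (by simp)]
          rfl
        · simp [u₁, h]
      · intro a
        rw [hΘ₁b]
        by_cases h : τ a < 1
        · simp [u₁, u₂, h, hφ _ h, L, a.2]
        · simp [u₁, u₂, h, φ, a.2]
      · intro k t ht
        simp [n₁]
      · intro k t ht
        rw [hΘ₁s k t ht]
        simp [n₁, n₂, H0, L, k.2.1]
    have E₂ : Θ₁.Homotopic Θ₂ := by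
      refine homotopic_of f u₂ n₂ h₂1 ?_ hΘ₁b hΘ₂b hΘ₁s ?_
      · intro k k' v hv
        simp [n₂, hL1]
      · intro k t ht
        rw [hΘ₂s k t ht]
        simp [n₂, n₃]
    have E₃ : Θ₂.Homotopic (φ.comp ψ) := by
      refine homotopic_of f u₂ n₃ h₃1 ?_ hΘ₂b ?_ hΘ₂s ?_
      · intro k k' v hv
        simp [n₃, H1]
      · intro a
        simp [hψb, u₂]
      · intro k t ht
        rw [ContinuousMap.comp_apply, hψs k t ht]
        simp only [n₃, ContinuousMap.coe_mk, sub_self, zero_mul]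
        exact hφ _ (H (⟨k, k.2.2⟩, 1 - t)).2
    exact ((E₁.trans E₂).trans E₃).symm

end Recognition

section Merge

open MappingCone

variable {W : Type u} [TopologicalSpace W] {ι : Type*} [Fintype ι]

/-- A path in a path connected space that is constant near prescribed separated parameters. -/
theorem exists_continuousMap_eq_of_abs_sub_lt {O : Type*} [TopologicalSpace O]
    [PathConnectedSpace O] {ι : Type*} {n : ι → ℝ} (hn : ∀ a b, a ≠ b → 1 ≤ |n a - n b|)
    (hc : IsClosed {x | ∃ a, |x - n a| ≤ 2 / 5}) (e : ι → O) :
    ∃ γ : C(ℝ, O), ∀ a x, |x - n a| < 1 / 4 → γ x = e a := by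
  classical
  obtain ⟨o⟩ : Nonempty O := inferInstance
  let P : ∀ a, Path o (e a) := fun a => PathConnectedSpace.somePath o (e a)
  let F : ℝ → O := fun x =>
    if h : ∃ a, |x - n a| < 1 / 2 then (P h.choose).extend (4 - 10 * |x - n h.choose|) else o
  have hF : ∀ a x, |x - n a| < 1 / 2 → F x = (P a).extend (4 - 10 * |x - n a|) := by
    intro a x hx
    have h : ∃ a, |x - n a| < 1 / 2 := ⟨a, hx⟩
    have ha : h.choose = a := by
      by_contra hne
      have h1 := hn _ _ hne
      have h2 := h.choose_spec
      rw [abs_lt] at hx h2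
      rcases le_abs.1 h1 with h1 | h1 <;> linarith
    simp only [F, dif_pos h]
    rw [ha]
  refine ⟨⟨F, ?_⟩, fun a x hx => ?_⟩
  · refine continuous_of_isOpen_iUnion (κ := Option ι)
      (P := fun i => i.elim {x | ∃ a, |x - n a| ≤ 2 / 5}ᶜ fun a => {x | |x - n a| < 1 / 2}) ?_ ?_ ?_
    · rintro (_ | a)
      · exact hc.isOpen_compl
      · exact isOpen_lt (by fun_prop) (by fun_prop)
    · intro x
      by_cases h : ∃ a, |x - n a| ≤ 2 / 5
      · obtain ⟨a, ha⟩ := h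
        exact ⟨some a, lt_of_le_of_lt ha (by norm_num)⟩
      · exact ⟨none, h⟩
    · rintro (_ | a)
      · refine ⟨fun _ => o, continuous_const, fun ⟨x, hx⟩ => ?_⟩
        by_cases h : ∃ a, |x - n a| < 1 / 2
        · obtain ⟨a, ha⟩ := h
          have : 2 / 5 < |x - n a| := by
            by_contra! hxa
            exact hx ⟨a, hxa⟩
          rw [hF a x ha, Path.extend_of_le_zero _ (by linarith)]
        · exact dif_neg h
      · exact ⟨fun x => (P a).extend (4 - 10 * |x.1 - n a|),
          (P a).continuous_extend.comp (by fun_prop), fun x => hF a x x.2⟩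
  · exact (hF a x (by linarith)).trans (Path.extend_of_one_le _ (by linarith))

/-- The space over `W` in which the pieces `{0 < τ a}` are placed at distinct parameters and
joined along the path `γ`. -/
def spread (τ₀ : C(W, ℝ)) (τ : ι → C(W, ℝ)) (n : ι → ℝ) (γ : ℝ → W) : Set (W × ℝ × ℝ) :=
  {z | (0 < τ₀ z.1 ∨ ∃ a, 0 < τ a z.1 ∧ |z.2.1 - n a| < 1 / 4) ∧ (z.2.2 ≤ 0 ∨ z.1 = γ z.2.1)}

/-- The measure of how far a point is from the part of `spread` lying over `{0 < τ₀}` only. -/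
noncomputable def spreadHeight (τ : ι → C(W, ℝ)) (n : ι → ℝ) : C(W × ℝ × ℝ, ℝ) :=
  ⟨fun z => max 0 (z.2.2 - 1 / 2) + ∑ a, τ a z.1 * max 0 (1 / 4 - |z.2.1 - n a|), by fun_prop⟩

theorem spreadHeight_nonneg {τ : ι → C(W, ℝ)} (hτ : ∀ a w, 0 ≤ τ a w) (n : ι → ℝ)
    (z : W × ℝ × ℝ) : 0 ≤ spreadHeight τ n z :=
  add_nonneg (le_max_left _ _)
    (Finset.sum_nonneg fun a _ => mul_nonneg (hτ a _) (le_max_left _ _))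

theorem spreadHeight_pos_iff {τ : ι → C(W, ℝ)} (hτ : ∀ a w, 0 ≤ τ a w) (n : ι → ℝ)
    (z : W × ℝ × ℝ) : 0 < spreadHeight τ n z ↔
      1 / 2 < z.2.2 ∨ ∃ a, 0 < τ a z.1 ∧ |z.2.1 - n a| < 1 / 4 := by
  have hnn : ∀ a ∈ Finset.univ, 0 ≤ τ a z.1 * max 0 (1 / 4 - |z.2.1 - n a|) :=
    fun a _ => mul_nonneg (hτ a _) (le_max_left _ _)
  have hs := Finset.sum_nonneg hnn
  constructor
  · intro h
    by_contra! hcon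
    have h1 : max 0 (z.2.2 - 1 / 2) = 0 := max_eq_left (by linarith [hcon.1])
    have h2 : ∑ a, τ a z.1 * max 0 (1 / 4 - |z.2.1 - n a|) = 0 := by
      refine Finset.sum_eq_zero fun a _ => ?_
      rcases (hτ a z.1).eq_or_lt with h0 | h0
      · rw [← h0, zero_mul]
      · rw [max_eq_left (by linarith [hcon.2 a h0]), mul_zero]
    simp only [spreadHeight, ContinuousMap.coe_mk, h1, h2] at h
    norm_num at h
  · rintro (h | ⟨a, ha, h⟩)
    · exact add_pos_of_pos_of_nonneg (lt_max_of_lt_right (by linarith)) hs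
    · exact add_pos_of_nonneg_of_pos (le_max_left _ _) (Finset.sum_pos' hnn
        ⟨a, Finset.mem_univ a, mul_pos ha (lt_max_of_lt_right (by linarith))⟩)

/-- Over every subset of `W` the projection from `spread` is a homotopy equivalence. -/
theorem nonempty_homotopyEquiv_spread {τ₀ : C(W, ℝ)} {τ : ι → C(W, ℝ)} {n : ι → ℝ} {γ : ℝ → W}
    (h₀ : ∀ w, 0 ≤ τ₀ w) (hτ : ∀ a w, 0 ≤ τ a w)
    (hdisj : ∀ a b, a ≠ b → ∀ w, 0 < τ a w → 0 < τ b w → 0 < τ₀ w) (G : Set W) :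
    Nonempty ({z : W × ℝ × ℝ // z ∈ spread τ₀ τ n γ ∧ z.1 ∈ G} ≃ₕ
      {w : W // (0 < τ₀ w ∨ ∃ a, 0 < τ a w) ∧ w ∈ G}) := by
  have hsum : ∀ w, 0 ≤ ∑ a, τ a w := fun w => Finset.sum_nonneg fun a _ => hτ a w
  let σ : C({w : W // (0 < τ₀ w ∨ ∃ a, 0 < τ a w) ∧ w ∈ G}, ℝ) :=
    ⟨fun w => (∑ a, n a * τ a w) / (τ₀ w + ∑ a, τ a w), by
      refine Continuous.div (by fun_prop) (by fun_prop) fun w => ne_of_gt ?_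
      rcases w.2.1 with h | ⟨a, ha⟩
      · exact add_pos_of_pos_of_nonneg h (hsum _)
      · exact add_pos_of_nonneg_of_pos (h₀ _)
          (Finset.sum_pos' (fun a _ => hτ a _) ⟨a, Finset.mem_univ a, ha⟩)⟩
  have hσ : ∀ (w : {w : W // (0 < τ₀ w ∨ ∃ a, 0 < τ a w) ∧ w ∈ G}) a,
      ¬ 0 < τ₀ w.1 → 0 < τ a w → σ w = n a := by
    intro w a hw ha
    have hz : ∀ b ≠ a, τ b w = 0 := fun b hb =>
      ((hτ b w).eq_or_lt.resolve_right fun h => hw (hdisj b a hb w h ha)).symm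
    have h0 : τ₀ w = 0 := ((h₀ w).eq_or_lt.resolve_right hw).symm
    simp only [σ, ContinuousMap.coe_mk]
    rw [Finset.sum_eq_single a (fun b _ hb => by rw [hz b hb, mul_zero]) (by simp),
      Finset.sum_eq_single a (fun b _ hb => hz b hb) (by simp), h0, zero_add,
      mul_div_cancel_right₀ _ ha.ne']
  have base : ∀ z : {z : W × ℝ × ℝ // z ∈ spread τ₀ τ n γ ∧ z.1 ∈ G},
      (0 < τ₀ z.1.1 ∨ ∃ a, 0 < τ a z.1.1) ∧ z.1.1 ∈ G := fun z =>
    ⟨z.2.1.1.imp_right fun ⟨a, ha⟩ => ⟨a, ha.1⟩, z.2.2⟩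
  let p : C({z : W × ℝ × ℝ // z ∈ spread τ₀ τ n γ ∧ z.1 ∈ G},
      {w : W // (0 < τ₀ w ∨ ∃ a, 0 < τ a w) ∧ w ∈ G}) := ⟨fun z => ⟨z.1.1, base z⟩, by fun_prop⟩
  let s : C({w : W // (0 < τ₀ w ∨ ∃ a, 0 < τ a w) ∧ w ∈ G},
      {z : W × ℝ × ℝ // z ∈ spread τ₀ τ n γ ∧ z.1 ∈ G}) :=
    ⟨fun w => ⟨(w, σ w, 0), ⟨by
      by_cases hw : 0 < τ₀ w.1
      · exact Or.inl hw
      · obtain ⟨a, ha⟩ := w.2.1.resolve_left hw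
        refine Or.inr ⟨a, ha, ?_⟩
        simp [hσ w a hw ha], Or.inl le_rfl⟩, w.2.2⟩, by fun_prop⟩
  let r : C({z : W × ℝ × ℝ // z ∈ spread τ₀ τ n γ ∧ z.1 ∈ G},
      {z : W × ℝ × ℝ // z ∈ spread τ₀ τ n γ ∧ z.1 ∈ G}) :=
    ⟨fun z => ⟨(z.1.1, z.1.2.1, 0), ⟨z.2.1.1, Or.inl le_rfl⟩, z.2.2⟩, by fun_prop⟩
  have H₁ : (ContinuousMap.id _).Homotopic r := by
    refine Homotopic.of_unitInterval ⟨fun q => ⟨(q.1.1.1, q.1.1.2.1, (1 - q.2) * q.1.1.2.2),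
      ⟨q.1.2.1.1, q.1.2.1.2.imp_left fun h => ?_⟩, q.1.2.2⟩, by fun_prop⟩ (fun z => ?_) fun z => ?_
    · exact mul_nonpos_of_nonneg_of_nonpos (by linarith [q.2.2.2]) h
    · ext <;> simp
    · ext <;> simp [r]
  have H₂ : r.Homotopic (s.comp p) := by
    refine Homotopic.of_unitInterval
      ⟨fun q => ⟨(q.1.1.1, (1 - q.2) * q.1.1.2.1 + q.2 * σ (p q.1), 0),
        ⟨?_, Or.inl le_rfl⟩, q.1.2.2⟩, by fun_prop⟩ (fun z => ?_) fun z => ?_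
    · by_cases hw : 0 < τ₀ q.1.1.1
      · exact Or.inl hw
      · obtain ⟨a, ha, hx⟩ := q.1.2.1.1.resolve_left hw
        refine Or.inr ⟨a, ha, lt_of_le_of_lt ?_ hx⟩
        rw [hσ (p q.1) a hw ha, show (1 - (q.2 : ℝ)) * q.1.1.2.1 + q.2 * n a - n a =
          (1 - q.2) * (q.1.1.2.1 - n a) by ring, abs_mul]
        refine mul_le_of_le_one_left (abs_nonneg _) ?_
        rw [abs_le]
        constructor <;> linarith [q.2.2.1, q.2.2.2]
    · ext <;> simp [r]
    · ext <;> simp [s, p]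
  exact ⟨⟨p, s, (H₁.trans H₂).symm, .refl _⟩⟩

/-- The part of `spread` lying over the pieces `{0 < τ a}` and the end of the joining path. -/
abbrev SpreadEnd (τ₀ : C(W, ℝ)) (τ : ι → C(W, ℝ)) (n : ι → ℝ) (γ : ℝ → W) : Type u :=
  {z : W × ℝ × ℝ // z ∈ spread τ₀ τ n γ ∧
    (1 / 2 < z.2.2 ∨ ∃ a, 0 < τ a z.1 ∧ |z.2.1 - n a| < 1 / 4)}

/-- A half plane with vertical strips attached around the parameters `n a`. -/
abbrev Comb {ι : Type*} (n : ι → ℝ) : Type :=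
  {q : ℝ × ℝ // 1 / 2 < q.2 ∨ ∃ a, |q.1 - n a| < 1 / 4}

theorem nullhomotopic_id_comb {ι : Type*} (n : ι → ℝ) :
    (ContinuousMap.id (Comb n)).Nullhomotopic := by
  let m : C(Comb n, Comb n) := ⟨fun q => ⟨(q.1.1, max q.1.2 1),
    Or.inl (lt_max_of_lt_right (by norm_num))⟩, by fun_prop⟩
  have L₁ : (ContinuousMap.id (Comb n)).Homotopic m := by
    refine Homotopic.of_unitInterval
      ⟨fun p => ⟨(p.1.1.1, (1 - p.2) * p.1.1.2 + p.2 * max p.1.1.2 1), p.1.2.imp_left fun h => ?_⟩,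
        by fun_prop⟩ (fun z => ?_) fun z => ?_
    · exact convex_Ioi (1 / 2 : ℝ) h (h.trans_le (le_max_left _ _)) (sub_nonneg.2 p.2.2.2) p.2.2.1
        (sub_add_cancel _ _)
    · ext <;> simp
    · ext <;> simp [m]
  refine ⟨⟨(0, 1), Or.inl (by norm_num)⟩, L₁.trans ?_⟩
  refine Homotopic.of_unitInterval
    ⟨fun p => ⟨((1 - p.2) * p.1.1.1, (1 - p.2) * max p.1.1.2 1 + p.2 * 1), Or.inl ?_⟩,
      by fun_prop⟩ (fun z => ?_) fun z => ?_
  · exact convex_Ioi (1 / 2 : ℝ) (lt_max_of_lt_right (by norm_num) : (1 / 2 : ℝ) < max p.1.1.2 1)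
      (by norm_num : (1 / 2 : ℝ) < 1) (sub_nonneg.2 p.2.2.2) p.2.2.1 (sub_add_cancel _ _)
  · ext <;> simp [m]
  · ext <;> simp

theorem contractibleSpace_spread {τ₀ : C(W, ℝ)} {τ : ι → C(W, ℝ)} {n : ι → ℝ}
    [∀ a, ContractibleSpace {w // 0 < τ a w}]
    (hn : ∀ a b, a ≠ b → 1 ≤ |n a - n b|) {γ : ℝ → W} (hγ : Continuous γ)
    (hγ₀ : ∀ x, 0 < τ₀ (γ x)) {e : ι → W} (he : ∀ a, 0 < τ a (e a))
    (hγe : ∀ a x, |x - n a| < 1 / 4 → γ x = e a) :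
    ContractibleSpace (SpreadEnd τ₀ τ n γ) := by
  classical
  choose c H H0 H1 using fun a => ContractibleSpace.exists_contraction {w // 0 < τ a w}
  have huniq : ∀ a b x, |x - n a| < 1 / 4 → |x - n b| < 1 / 4 → a = b := by
    intro a b x ha hb
    by_contra hne
    rw [abs_lt] at ha hb
    rcases le_abs.1 (hn _ _ hne) with h | h <;> linarith
  obtain ⟨J, hJ, hJ0⟩ : ∃ J : W → ℝ → ℝ → W,
      (∀ w x s a (ha : 0 < τ a w), |x - n a| < 1 / 4 → J w x s = H a (⟨w, ha⟩, s)) ∧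
      ∀ w x s, s ≤ 0 → J w x s = w := by
    refine ⟨fun w x s => if h : ∃ a, 0 < τ a w ∧ |x - n a| < 1 / 4 then
      H h.choose (⟨w, h.choose_spec.1⟩, s) else w, fun w x s a ha hx => ?_, fun w x s hs => ?_⟩
    · have h : ∃ a, 0 < τ a w ∧ |x - n a| < 1 / 4 := ⟨a, ha, hx⟩
      obtain rfl : h.choose = a := huniq _ _ x h.choose_spec.2 hx
      exact dif_pos h
    · by_cases h : ∃ a, 0 < τ a w ∧ |x - n a| < 1 / 4
      · simp only [dif_pos h, H0 _ _ _ hs]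
      · exact dif_neg h
  have hJτ : ∀ w x s a, 0 < τ a w → |x - n a| < 1 / 4 → 0 < τ a (J w x s) := by
    intro w x s a ha hx
    rw [hJ w x s a ha hx]
    exact (H a (⟨w, ha⟩, s)).2
  let ρ : C(ℝ, ℝ) := ⟨fun u => min u (max 0 (2 * u - 1 / 2)), by fun_prop⟩
  have hρ0 : ∀ u, u ≤ 1 / 4 → ρ u ≤ 0 := fun u hu =>
    (min_le_right _ _).trans (max_le le_rfl (by linarith))
  have hρh : ∀ u, 1 / 2 < u → 1 / 2 < ρ u := fun u hu =>
    lt_min hu (lt_max_of_lt_right (by linarith))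
  have hρ : ∀ u, u ≤ 0 → ρ u = u := fun u hu => min_eq_left (le_max_of_le_left hu)
  let R : C(SpreadEnd τ₀ τ n γ, SpreadEnd τ₀ τ n γ) := ⟨fun z => ⟨(z.1.1, z.1.2.1, ρ z.1.2.2),
    ⟨z.2.1.1, z.2.1.2.imp_left fun h => (hρ _ h).trans_le h⟩, z.2.2.imp_left fun h => hρh _ h⟩,
    by fun_prop⟩
  have K₁ : (ContinuousMap.id (SpreadEnd τ₀ τ n γ)).Homotopic R := by
    refine Homotopic.of_unitInterval
      ⟨fun q => ⟨(q.1.1.1, q.1.1.2.1, (1 - q.2) * q.1.1.2.2 + q.2 * ρ q.1.1.2.2),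
        ⟨q.1.2.1.1, q.1.2.1.2.imp_left fun h => ?_⟩, q.1.2.2.imp_left fun h => ?_⟩, by fun_prop⟩
        (fun z => ?_) fun z => ?_
    · rw [hρ _ h]
      linarith
    · exact convex_Ioi (1 / 2 : ℝ) h (hρh _ h) (sub_nonneg.2 q.2.2.2) q.2.2.1
        (sub_add_cancel _ _)
    · ext <;> simp
    · ext <;> simp [R]
  have hmem : ∀ (z : SpreadEnd τ₀ τ n γ) (t : ℝ), 0 ≤ t →
      (J z.1.1 z.1.2.1 (t * (1 - 4 * z.1.2.2)), z.1.2.1, ρ z.1.2.2) ∈ spread τ₀ τ n γ ∧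
      (1 / 2 < ρ z.1.2.2 ∨ ∃ a, 0 < τ a (J z.1.1 z.1.2.1 (t * (1 - 4 * z.1.2.2))) ∧
        |z.1.2.1 - n a| < 1 / 4) := by
    rintro ⟨⟨w, x, u⟩, ⟨hz₁, hz₂⟩, hz₃⟩ t ht
    dsimp only at hz₁ hz₂ hz₃ ⊢
    rcases le_or_gt u (1 / 4) with hu | hu
    · obtain ⟨a, ha, hx⟩ := hz₃.resolve_left (by linarith)
      have := hJτ w x (t * (1 - 4 * u)) a ha hx
      exact ⟨⟨Or.inr ⟨a, this, hx⟩, Or.inl (hρ0 _ hu)⟩, Or.inr ⟨a, this, hx⟩⟩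
    · rw [hJ0 _ _ _ (mul_nonpos_of_nonneg_of_nonpos ht (by linarith))]
      exact ⟨⟨hz₁, Or.inr (hz₂.resolve_left (by linarith))⟩, hz₃.imp_left fun h => hρh _ h⟩
  have hcont : Continuous fun q : SpreadEnd τ₀ τ n γ × unitInterval =>
      J q.1.1.1 q.1.1.2.1 (q.2 * (1 - 4 * q.1.1.2.2)) := by
    refine continuous_of_isOpen_iUnion (κ := Option ι) (P := fun i => i.elim
      {q | 1 / 4 < q.1.1.2.2} fun a => {q | q.1.1.2.2 < 1 / 2 ∧ |q.1.1.2.1 - n a| < 1 / 4}) ?_ ?_ ?_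
    · rintro (_ | a)
      · exact isOpen_lt (by fun_prop) (by fun_prop)
      · exact (isOpen_lt (f := fun q : SpreadEnd τ₀ τ n γ × unitInterval => q.1.1.2.2)
          (by fun_prop) continuous_const).inter (isOpen_lt
          (f := fun q : SpreadEnd τ₀ τ n γ × unitInterval => |q.1.1.2.1 - n a|)
          (by fun_prop) continuous_const)
    · intro q
      rcases lt_or_ge (1 / 4) q.1.1.2.2 with h | h
      · exact ⟨none, h⟩
      · obtain ⟨a, -, ha⟩ := q.1.2.2.resolve_left (by linarith)
        exact ⟨some a, lt_of_le_of_lt h (by norm_num), ha⟩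
    · rintro (_ | a)
      · refine ⟨fun q => q.1.1.1.1, by fun_prop, fun q => hJ0 _ _ _ ?_⟩
        have : 1 / 4 < q.1.1.1.2.2 := q.2
        exact mul_nonpos_of_nonneg_of_nonpos q.1.2.2.1 (by linarith)
      · have hpos : ∀ q : ((some a).elim
            {q : SpreadEnd τ₀ τ n γ × unitInterval | 1 / 4 < q.1.1.2.2} fun a =>
            {q | q.1.1.2.2 < 1 / 2 ∧ |q.1.1.2.1 - n a| < 1 / 4} :
              Set (SpreadEnd τ₀ τ n γ × unitInterval)),
            0 < τ a q.1.1.1.1 := by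
          intro q
          obtain ⟨b, hb, hx⟩ := q.1.1.2.2.resolve_left (not_lt.2 (le_of_lt q.2.1))
          exact (congrArg (fun i => 0 < τ i q.1.1.1.1) (huniq a b _ q.2.2 hx)).mpr hb
        exact ⟨fun q => H a (⟨q.1.1.1.1, hpos q⟩, q.1.2 * (1 - 4 * q.1.1.1.2.2)), by fun_prop,
          fun q => hJ _ _ _ a _ q.2.2⟩
  let Ψ : C(SpreadEnd τ₀ τ n γ, SpreadEnd τ₀ τ n γ) :=
    ⟨fun z => ⟨(J z.1.1 z.1.2.1 (1 * (1 - 4 * z.1.2.2)), z.1.2.1, ρ z.1.2.2),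
    hmem z 1 zero_le_one⟩, by
      have : Continuous fun z : SpreadEnd τ₀ τ n γ => J z.1.1 z.1.2.1 (1 * (1 - 4 * z.1.2.2)) :=
        hcont.comp (continuous_id.prodMk (continuous_const (y := (1 : unitInterval))))
      exact (this.prodMk (by fun_prop)).subtype_mk _⟩
  have K₂ : R.Homotopic Ψ := by
    refine Homotopic.of_unitInterval
      ⟨fun q => ⟨(J q.1.1.1 q.1.1.2.1 (q.2 * (1 - 4 * q.1.1.2.2)), q.1.1.2.1, ρ q.1.1.2.2),
        hmem q.1 q.2 q.2.2.1⟩, (hcont.prodMk (by fun_prop)).subtype_mk _⟩ (fun z => ?_) fun z => ?_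
    · refine Subtype.ext (Prod.ext ?_ rfl)
      exact hJ0 _ _ _ (by simp)
    · simp [Ψ]
  let π : C(SpreadEnd τ₀ τ n γ, Comb n) :=
    ⟨fun z => ⟨z.1.2, z.2.2.imp_right fun ⟨a, ha⟩ => ⟨a, ha.2⟩⟩, by fun_prop⟩
  let j : C(Comb n, SpreadEnd τ₀ τ n γ) :=
    ⟨fun q => ⟨(γ q.1.1, q.1.1, q.1.2), ⟨Or.inl (hγ₀ _), Or.inr rfl⟩,
    q.2.imp_right fun ⟨a, ha⟩ => ⟨a, by rw [hγe a _ ha]; exact he a, ha⟩⟩, by fun_prop⟩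
  have hΨ : Ψ = (Ψ.comp j).comp π := by
    ext z : 1
    obtain ⟨⟨w, x, u⟩, ⟨hz₁, hz₂⟩, hz₃⟩ := z
    dsimp only at hz₁ hz₂ hz₃
    refine Subtype.ext (Prod.ext ?_ rfl)
    change J w x (1 * (1 - 4 * u)) = J (γ x) x (1 * (1 - 4 * u))
    rcases hz₂ with hu | rfl
    · obtain ⟨a, ha, hx⟩ := hz₃.resolve_left (by linarith)
      rw [hJ w x _ a ha hx, hJ (γ x) x _ a (by rw [hγe a x hx]; exact he a) hx,
        H1 _ _ _ (by linarith), H1 _ _ _ (by linarith)]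
    · rfl
  rw [contractible_iff_id_nullhomotopic]
  obtain ⟨y, hy⟩ := ((nullhomotopic_id_comb n).comp_left π).comp_right (Ψ.comp j)
  refine ⟨y, (K₁.trans K₂).trans ?_⟩
  rw [hΨ]
  exact hy

/-- Adding to a path connected open set finitely many contractible open sets, whose pairwise
intersections it contains, amounts up to homotopy to attaching a cone. -/
theorem exists_homotopyEquiv_mappingCone (τ₀ : C(W, ℝ)) (τ : ι → C(W, ℝ)) (h₀ : ∀ w, 0 ≤ τ₀ w)
    (hτ : ∀ a w, 0 ≤ τ a w) (hdisj : ∀ a b, a ≠ b → ∀ w, 0 < τ a w → 0 < τ b w → 0 < τ₀ w)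
    [PathConnectedSpace {w // 0 < τ₀ w}] [∀ a, ContractibleSpace {w // 0 < τ a w}]
    (he : ∀ a, ∃ w, 0 < τ a w ∧ 0 < τ₀ w) :
    ∃ (K : TopCat.{u}) (f : C(K, {w // 0 < τ₀ w})),
      Nonempty ({w // 0 < τ₀ w ∨ ∃ a, 0 < τ a w} ≃ₕ MappingCone f) := by
  choose e heτ he₀ using he
  let n : ι → ℝ := fun a => (Fintype.equivFin ι a : ℕ)
  have hn : ∀ a b, a ≠ b → 1 ≤ |n a - n b| := by
    intro a b hab
    have h : ((Fintype.equivFin ι a : ℕ) : ℤ) - (Fintype.equivFin ι b : ℕ) ≠ 0 := by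
      rw [sub_ne_zero]
      exact fun h => hab ((Fintype.equivFin ι).injective (Fin.ext (by exact_mod_cast h)))
    have := Int.one_le_abs h
    simp only [n]
    exact_mod_cast this
  have hc : IsClosed {x | ∃ a, |x - n a| ≤ 2 / 5} := by
    rw [Set.ofPred_exists]
    exact isClosed_iUnion_of_finite fun a => isClosed_le (by fun_prop) continuous_const
  obtain ⟨γ, hγ⟩ := exists_continuousMap_eq_of_abs_sub_lt (O := {w // 0 < τ₀ w}) hn hc
    fun a => ⟨e a, he₀ a⟩
  let g : ℝ → W := fun x => γ x
  have hg : Continuous g := by fun_prop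
  have := contractibleSpace_spread (τ₀ := τ₀) hn hg (fun x => (γ x).2) heτ
    fun a x hx => congrArg Subtype.val (hγ a x hx)
  let M := spread τ₀ τ n g
  have hnn : ∀ z : M, 0 ≤ spreadHeight τ n z := fun z => spreadHeight_nonneg hτ n z
  have hpos : ∀ z : M, 0 < τ₀ z.1.1 + spreadHeight τ n z := by
    intro z
    rcases z.2.1 with h | h
    · exact add_pos_of_pos_of_nonneg h (hnn z)
    · exact add_pos_of_nonneg_of_pos (h₀ _) ((spreadHeight_pos_iff hτ n z).2 (Or.inr h))
  let θ : C(M, ℝ) := ⟨fun z => τ₀ z.1.1 / (τ₀ z.1.1 + spreadHeight τ n z),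
    Continuous.div (by fun_prop) (by fun_prop) fun z => (hpos z).ne'⟩
  have hθ₀ : ∀ z, 0 < θ z ↔ 0 < τ₀ z.1.1 := fun z => div_pos_iff_of_pos_right (hpos z)
  have hθ₁ : ∀ z : M, θ z < 1 ↔ 1 / 2 < z.1.2.2 ∨ ∃ a, 0 < τ a z.1.1 ∧ |z.1.2.1 - n a| < 1 / 4 := by
    intro z
    rw [← spreadHeight_pos_iff hτ]
    simp only [θ, ContinuousMap.coe_mk]
    rw [div_lt_one (hpos z), lt_add_iff_pos_right]
  have e₁ : {z : M // θ z < 1} ≃ₜ SpreadEnd τ₀ τ n g :=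
    { toFun := fun z => ⟨z.1.1, z.1.2, (hθ₁ z.1).1 z.2⟩
      invFun := fun z => ⟨⟨z.1, z.2.1⟩, (hθ₁ _).2 z.2.2⟩
      left_inv := fun z => rfl
      right_inv := fun z => rfl
      continuous_toFun := by fun_prop
      continuous_invFun := by fun_prop }
  have := e₁.contractibleSpace
  obtain ⟨ε⟩ := nonempty_homotopyEquiv_overlapInclusion θ
    ⟨⟨(g 0, 0, 1), Or.inl (γ 0).2, Or.inr rfl⟩, (hθ₀ _).2 (γ 0).2, (hθ₁ _).2
      (Or.inl (by norm_num))⟩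
  obtain ⟨ε₀⟩ := nonempty_homotopyEquiv_spread (γ := g) (n := n) h₀ hτ hdisj {w | 0 < τ₀ w}
  obtain ⟨ε₁⟩ := nonempty_homotopyEquiv_spread (γ := g) (n := n) h₀ hτ hdisj univ
  have e₂ : {z : M // 0 < θ z} ≃ₜ {z // z ∈ spread τ₀ τ n g ∧ z.1 ∈ {w | 0 < τ₀ w}} :=
    { toFun := fun z => ⟨z.1.1, z.1.2, (hθ₀ z.1).1 z.2⟩
      invFun := fun z => ⟨⟨z.1, z.2.1⟩, (hθ₀ _).2 z.2.2⟩
      left_inv := fun z => rfl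
      right_inv := fun z => rfl
      continuous_toFun := by fun_prop
      continuous_invFun := by fun_prop }
  have e₃ : {w : W // (0 < τ₀ w ∨ ∃ a, 0 < τ a w) ∧ w ∈ {w | 0 < τ₀ w}} ≃ₜ {w // 0 < τ₀ w} :=
    (Homeomorph.refl W).subtype fun w => ⟨fun h => h.2, fun h => ⟨Or.inl h, h⟩⟩
  have e₄ : M ≃ₜ {z // z ∈ spread τ₀ τ n g ∧ z.1 ∈ univ} :=
    (Homeomorph.refl _).subtype fun w => ⟨fun h => ⟨h, trivial⟩, And.left⟩
  have e₅ : {w : W // (0 < τ₀ w ∨ ∃ a, 0 < τ a w) ∧ w ∈ univ} ≃ₜ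
      {w : W // 0 < τ₀ w ∨ ∃ a, 0 < τ a w} :=
    (Homeomorph.refl W).subtype fun w => ⟨And.left, fun h => ⟨h, trivial⟩⟩
  obtain ⟨ε₂⟩ := nonempty_homotopyEquiv_comp (overlapInclusion θ)
    ((e₂.toHomotopyEquiv.trans ε₀).trans e₃.toHomotopyEquiv)
  exact ⟨TopCat.of _, _, ⟨(((e₅.symm.toHomotopyEquiv.trans ε₁.symm).trans
    e₄.symm.toHomotopyEquiv).trans ε).trans ε₂⟩⟩

end Merge

/-- Functions `p 0, …, p m` on `X` whose positivity sets cover `X`, are contractible, and each of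
which but the first meets an earlier one. -/
structure IsGoodCover {X : Type*} [TopologicalSpace X] (p : ℕ → C(X, ℝ)) (m : ℕ) : Prop where
  nonneg : ∀ i x, 0 ≤ p i x
  exists_pos : ∀ x, ∃ i ≤ m, 0 < p i x
  eq_zero : ∀ i, m < i → ∀ x, p i x = 0
  zero_nonempty : ∃ x, 0 < p 0 x
  contractible : ∀ i, (∃ x, 0 < p i x) → ContractibleSpace {x // 0 < p i x}
  meets : ∀ i ≠ 0, (∃ x, 0 < p i x) → ∃ x, 0 < p i x ∧ ∃ j < i, 0 < p j x

theorem IsGoodCover.comp_homeomorph {X Y : Type*} [TopologicalSpace X] [TopologicalSpace Y]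
    {p : ℕ → C(X, ℝ)} {m : ℕ} (hp : IsGoodCover p m) (e : Y ≃ₜ X) :
    IsGoodCover (fun i => (p i).comp (e : C(Y, X))) m where
  nonneg i y := hp.nonneg i _
  exists_pos y := hp.exists_pos _
  eq_zero i hi y := hp.eq_zero i hi _
  zero_nonempty := e.surjective.exists.1 hp.zero_nonempty
  contractible i h := by
    have := hp.contractible i (e.surjective.exists.2 h)
    exact (e.subtype fun y => Iff.rfl : {y // 0 < p i (e y)} ≃ₜ {x // 0 < p i x}).contractibleSpace
  meets i hi h := e.surjective.exists.1 (hp.meets i hi (e.surjective.exists.2 h))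

theorem isGoodCover_const_one {X : Type*} [TopologicalSpace X] [Unique X] :
    IsGoodCover (fun i : ℕ => if i = 0 then (1 : C(X, ℝ)) else 0) 0 where
  nonneg i x := by split_ifs <;> simp
  exists_pos x := ⟨0, le_rfl, by simp⟩
  eq_zero i hi x := by simp [hi.ne']
  zero_nonempty := ⟨default, by simp⟩
  contractible i := by
    rintro ⟨x, hx⟩
    have : Nonempty {x : X // 0 < (if i = 0 then (1 : C(X, ℝ)) else 0) x} := ⟨x, hx⟩
    infer_instance
  meets i hi := by simp [hi]

namespace MappingCone

variable {K A : Type u} [TopologicalSpace K] [TopologicalSpace A]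

/-- The height function on a mapping cone, with value `1` on the base. -/
theorem exists_height (f : C(K, A)) : ∃ t : C(MappingCone f, ℝ), (∀ a, t (base f a) = 1) ∧
    ∀ k, ∀ s ∈ Icc (0 : ℝ) 1, t (seg f k s) = s :=
  exists_desc f (ContinuousMap.const A 1) ⟨fun p => p.2, by fun_prop⟩ (fun k => rfl) fun k k' => rfl

/-- A mapping cone without its apex retracts to the base. -/
theorem exists_retraction (f : C(K, A)) (t : C(MappingCone f, ℝ))
    (hs : ∀ k, ∀ s ∈ Icc (0 : ℝ) 1, t (seg f k s) = s) :
    ∃ r : C({c // 0 < t c}, A), (∀ a h, r ⟨base f a, h⟩ = a) ∧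
      ∀ k, ∀ s ∈ Icc (0 : ℝ) 1, ∀ h, r ⟨seg f k s, h⟩ = f k := by
  have hq := (isQuotientMap_quot_mk (r := ConeRel f)).restrictPreimage_isOpen
    (s := {c | 0 < t c}) (isOpen_lt continuous_const t.continuous)
  let g : C(Quot.mk (ConeRel f) ⁻¹' {c | 0 < t c}, A) :=
    ⟨fun z => Sum.elim (fun p => f p.1) id z.1,
      (Continuous.sumElim (by fun_prop) continuous_id).comp continuous_subtype_val⟩
  have hs' : ∀ (k : K) (s : unitInterval), t (Quot.mk _ (Sum.inl (k, s))) = s := fun k s => by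
    rw [← hs k s s.2, seg, projIcc_of_mem _ s.2]
  have hg : ∀ y z : (K × unitInterval) ⊕ A, Quot.mk (ConeRel f) y = Quot.mk _ z →
      0 < t (Quot.mk _ y) → Sum.elim (fun p => f p.1) id y = Sum.elim (fun p => f p.1) id z := by
    intro y z h
    have h' := Quot.eqvGen_exact h
    clear h
    induction h' with
    | rel y z h =>
      rcases h with k | ⟨k, k'⟩
      · exact fun _ => rfl
      · intro h
        rw [hs'] at h
        simp at h
    | refl => exact fun _ => rfl
    | symm y z h ih =>
      intro hz
      exact (ih (by rwa [Quot.eqvGen_sound h])).symm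
    | trans x y z h _ ih ih' =>
      intro hx
      exact (ih hx).trans (ih' (by rwa [← Quot.eqvGen_sound h]))
  let π : C(Quot.mk (ConeRel f) ⁻¹' {c | 0 < t c}, {c // 0 < t c}) := ⟨_, hq.continuous⟩
  have hπ : IsQuotientMap π := hq
  have hg' : Function.FactorsThrough g π := fun y z h =>
    hg y.1 z.1 (congrArg Subtype.val h) y.2
  refine ⟨hπ.lift g hg', fun a h => ?_, fun k s hs₁ h => ?_⟩
  · exact congrArg (fun F => F ⟨Sum.inr a, h⟩) (hπ.lift_comp g hg')
  · exact congrArg (fun F => F ⟨Sum.inl (k, projIcc 0 1 zero_le_one s), h⟩) (hπ.lift_comp g hg')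

theorem exists_isGoodCover (f : C(K, A)) {p : ℕ → C(A, ℝ)} {m : ℕ} (hp : IsGoodCover p m) :
    ∃ p' : ℕ → C(MappingCone f, ℝ), IsGoodCover p' (m + 1) := by
  obtain ⟨t, htb, hts⟩ := exists_height f
  obtain ⟨r, hrb, hrs⟩ := exists_retraction f t hts
  choose q hqb hqs using fun j => exists_desc f (⟨fun a => p j a * max 0 (1 - 1 / 3), by fun_prop⟩)
    ⟨fun x : K × ℝ => p j (f x.1) * max 0 (x.2 - 1 / 3), by fun_prop⟩ (fun k => rfl)
    (fun k k' => by norm_num)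
  simp only [ContinuousMap.coe_mk] at hqb hqs
  have hqb' : ∀ j a, 0 < q j (base f a) ↔ 0 < p j a := fun j a => by
    rw [hqb]
    exact mul_pos_iff_of_pos_right (by norm_num)
  have hqs' : ∀ j k, ∀ s ∈ Icc (0 : ℝ) 1, 0 < q j (seg f k s) ↔ 0 < p j (f k) ∧ 1 / 3 < s := by
    intro j k s hs
    rw [hqs _ _ _ hs]
    constructor
    · intro h
      have h1 := pos_of_mul_pos_left h (le_max_left _ _)
      refine ⟨h1, ?_⟩
      have := (mul_pos_iff_of_pos_left h1).1 h
      rcases lt_max_iff.1 this with h | h <;> linarith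
    · rintro ⟨h, hs⟩
      exact mul_pos h (lt_max_of_lt_right (by linarith))
  have hq0 : ∀ j c, 0 ≤ q j c := by
    intro j
    refine ind (fun a => ?_) fun k s hs => ?_
    · rw [hqb]
      exact mul_nonneg (hp.nonneg _ _) (le_max_left _ _)
    · rw [hqs _ _ _ hs]
      exact mul_nonneg (hp.nonneg _ _) (le_max_left _ _)
  have hqA : ∀ j, (∃ c, 0 < q j c) → ∃ a, 0 < p j a := by
    rintro j ⟨c, hc⟩
    revert c
    refine ind (fun a ha => ?_) fun k s hs h => ?_
    · exact ⟨a, (hqb' _ _).1 ha⟩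
    · exact ⟨f k, ((hqs' _ _ _ hs).1 h).1⟩
  -- the old pieces are contractible
  have hcon : ∀ j, (∃ c, 0 < q j c) → ContractibleSpace {c // 0 < q j c} := by
    intro j hj
    have := hp.contractible j (hqA j hj)
    obtain ⟨G, hGb, hGs⟩ := exists_desc_homotopy f ⟨fun x => base f x.1, by fun_prop⟩
      ⟨fun x => seg f x.1 ((1 + 2 * x.2.2) * x.2.1), by fun_prop⟩
      (fun k v hv => seg_of_one_le f k (by dsimp only; linarith [hv.1]))
      (fun k k' v hv => seg_of_nonpos f k k' (by simp) (by simp))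
    simp only [ContinuousMap.coe_mk] at hGb hGs
    have hG : ∀ c v, 0 < q j c → 0 < q j (G (c, v)) := by
      intro c v
      revert c
      refine ind (fun a => ?_) fun k s hs h => ?_
      · rw [hGb]
        exact id
      · rw [hGs k s hs]
        rw [hqs' _ _ _ hs] at h
        rcases le_or_gt 1 ((1 + 2 * (v : ℝ)) * s) with h1 | h1
        · rw [seg_of_one_le _ _ h1, hqb']
          exact h.1
        · rw [hqs' _ _ _ ⟨by nlinarith [v.2.1, hs.1], h1.le⟩]
          exact ⟨h.1, by nlinarith [v.2.1, h.2]⟩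
    have htpos : ∀ c, 0 < q j c → 0 < t c := by
      refine ind (fun a _ => ?_) fun k s hs h => ?_
      · rw [htb]
        exact one_pos
      · rw [hts k s hs]
        linarith [((hqs' _ _ _ hs).1 h).2]
    have hr : ∀ c (h : 0 < q j c), 0 < p j (r ⟨c, htpos c h⟩) := by
      refine ind (fun a h => ?_) fun k s hs h => ?_
      · rw [hrb]
        exact (hqb' _ _).1 h
      · rw [hrs k s hs]
        exact ((hqs' _ _ _ hs).1 h).1
    let ρ : C({c // 0 < q j c}, {a // 0 < p j a}) :=
      ⟨fun c => ⟨r ⟨c, htpos c c.2⟩, hr c c.2⟩, by fun_prop⟩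
    let i : C({a // 0 < p j a}, {c // 0 < q j c}) :=
      ⟨fun a => ⟨base f a, (hqb' _ _).2 a.2⟩, by fun_prop⟩
    have H : (ContinuousMap.id _).Homotopic (i.comp ρ) := by
      refine Homotopic.of_unitInterval ⟨fun x => ⟨G (x.1, x.2), hG _ _ x.1.2⟩, by fun_prop⟩ ?_ ?_
      · rintro ⟨c, hc⟩
        refine Subtype.ext ?_
        revert c
        refine ind (fun a ha => ?_) fun k s hs h => ?_
        · exact hGb _ _
        · exact (hGs k s hs 0).trans (by simp)
      · rintro ⟨c, hc⟩
        refine Subtype.ext ?_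
        change G (c, 1) = base f (r ⟨c, htpos c hc⟩)
        revert c
        refine ind (fun a ha => ?_) fun k s hs h => ?_
        · rw [hGb, hrb]
        · rw [hGs k s hs, hrs k s hs, seg_of_one_le]
          have := ((hqs' _ _ _ hs).1 h).2
          norm_num
          linarith
    rw [contractible_iff_id_nullhomotopic]
    obtain ⟨y, hy⟩ := ((id_nullhomotopic {a // 0 < p j a}).comp_left ρ).comp_right i
    exact ⟨y, H.trans hy⟩
  let w : C(MappingCone f, ℝ) := ⟨fun c => max 0 (2 / 3 - t c), by fun_prop⟩
  have hw : ∀ c, 0 < w c ↔ t c < 2 / 3 := fun c => by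
    simp [w]
  have hwb : ∀ a, ¬ 0 < w (base f a) := fun a => by
    rw [hw, htb]
    norm_num
  have hws : ∀ k, ∀ s ∈ Icc (0 : ℝ) 1, 0 < w (seg f k s) ↔ s < 2 / 3 := fun k s hs => by
    rw [hw, hts k s hs]
  have hwK : (∃ c, 0 < w c) → Nonempty K := by
    rintro ⟨c, hc⟩
    revert c
    exact ind (fun a ha => (hwb a ha).elim) fun k _ _ _ => ⟨k⟩
  have hcon' : (∃ c, 0 < w c) → ContractibleSpace {c // 0 < w c} := by
    intro h
    obtain ⟨k₀⟩ := hwK h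
    obtain ⟨G, hGb, hGs⟩ := exists_desc_homotopy f ⟨fun x => base f x.1, by fun_prop⟩
      ⟨fun x => seg f x.1 (x.2.1 * (1 - x.2.2 * max 0 (min 1 (3 - 3 * x.2.1)))), by fun_prop⟩
      (fun k v hv => seg_of_one_le f k (by norm_num))
      (fun k k' v hv => seg_of_nonpos f k k' (by simp) (by simp))
    simp only [ContinuousMap.coe_mk] at hGb hGs
    have h01 : ∀ s ∈ Icc (0 : ℝ) 1, ∀ v : unitInterval,
        0 ≤ s * (1 - v * max 0 (min 1 (3 - 3 * s))) ∧
          s * (1 - v * max 0 (min 1 (3 - 3 * s))) ≤ s := by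
      intro s hs v
      have h0 : 0 ≤ max 0 (min 1 (3 - 3 * s)) := le_max_left _ _
      have h1 : max 0 (min 1 (3 - 3 * s)) ≤ 1 := max_le zero_le_one (min_le_left _ _)
      have h2 := mul_nonneg v.2.1 h0
      have h3 := mul_le_one₀ v.2.2 h0 h1
      exact ⟨mul_nonneg hs.1 (by linarith), mul_le_of_le_one_right hs.1 (by linarith)⟩
    have hG : ∀ c v, 0 < w c → 0 < w (G (c, v)) := by
      intro c v
      revert c
      refine ind (fun a ha => (hwb a ha).elim) fun k s hs h => ?_
      rw [hGs k s hs, hws _ _ ⟨(h01 s hs v).1, (h01 s hs v).2.trans hs.2⟩]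
      exact (h01 s hs v).2.trans_lt ((hws _ _ hs).1 h)
    rw [contractible_iff_id_nullhomotopic]
    refine ⟨⟨seg f k₀ 0, (hws _ _ (by simp)).2 (by norm_num)⟩, ?_⟩
    refine Homotopic.of_unitInterval ⟨fun x => ⟨G (x.1, x.2), hG _ _ x.1.2⟩, by fun_prop⟩ ?_ ?_
    · rintro ⟨c, hc⟩
      refine Subtype.ext ?_
      revert c
      refine ind (fun a ha => (hwb a ha).elim) fun k s hs h => ?_
      exact (hGs k s hs 0).trans (by simp)
    · rintro ⟨c, hc⟩
      refine Subtype.ext ?_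
      revert c
      refine ind (fun a ha => (hwb a ha).elim) fun k s hs h => ?_
      have := (hws _ _ hs).1 h
      refine (hGs k s hs 1).trans (seg_of_nonpos _ _ _ ?_ le_rfl)
      rw [min_eq_left (by linarith)]
      simp
  have hpos : ∀ c, ∃ i ≤ m + 1, 0 < (if i = m + 1 then w else q i) c := by
    refine ind (fun a => ?_) fun k s hs => ?_
    · obtain ⟨i, hi, ha⟩ := hp.exists_pos a
      exact ⟨i, by omega, by rw [if_neg (by omega)]; exact (hqb' _ _).2 ha⟩
    · rcases lt_or_ge s (2 / 3) with h | h
      · exact ⟨m + 1, le_rfl, by rw [if_pos rfl]; exact (hws _ _ hs).2 h⟩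
      · obtain ⟨i, hi, ha⟩ := hp.exists_pos (f k)
        exact ⟨i, by omega, by rw [if_neg (by omega)]; exact (hqs' _ _ _ hs).2 ⟨ha, by linarith⟩⟩
  refine ⟨fun i => if i = m + 1 then w else q i, ?_, hpos, ?_, ?_, ?_, ?_⟩
  · intro i c
    split_ifs
    · exact le_max_left _ _
    · exact hq0 i c
  · intro i hi c
    rw [if_neg (by omega)]
    have h0 := hp.eq_zero i (by omega)
    revert c
    refine ind (fun a => ?_) fun k s hs => ?_
    · rw [hqb, h0, zero_mul]
    · rw [hqs _ _ _ hs, h0, zero_mul]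
  · obtain ⟨a, ha⟩ := hp.zero_nonempty
    exact ⟨base f a, by rw [if_neg (by omega)]; exact (hqb' _ _).2 ha⟩
  · intro i
    generalize hg : (if i = m + 1 then w else q i) = g
    split_ifs at hg
    · exact hg ▸ hcon'
    · exact hg ▸ hcon i
  · intro i hi
    split_ifs with h
    · intro hc
      obtain ⟨k⟩ := hwK hc
      obtain ⟨j, hj, hk⟩ := hp.exists_pos (f k)
      have h12 : (1 / 2 : ℝ) ∈ Icc (0 : ℝ) 1 := by norm_num
      refine ⟨seg f k (1 / 2), (hws _ _ h12).2 (by norm_num), j, by omega, ?_⟩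
      rw [if_neg (by omega)]
      exact (hqs' _ _ _ h12).2 ⟨hk, by norm_num⟩
    · intro hc
      obtain ⟨a, ha, j, hj, ha'⟩ := hp.meets i hi (hqA i hc)
      have hjm : j ≠ m + 1 := by
        rintro rfl
        rw [hp.eq_zero _ (by omega)] at ha'
        exact ha'.false
      refine ⟨base f a, (hqb' _ _).2 ha, j, hj, ?_⟩
      rw [if_neg hjm]
      exact (hqb' _ _).2 ha'

end MappingCone

theorem ConeDecomp.exists_isGoodCover {X : Type u} [TopologicalSpace X] {m : ℕ}
    (D : ConeDecomp X m) : ∃ p : ℕ → C(D.F (Fin.last m), ℝ), IsGoodCover p m := by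
  suffices h : ∀ i : Fin (m + 1), ∃ p : ℕ → C(D.F i, ℝ), IsGoodCover p i by
    simpa using h (Fin.last m)
  intro i
  induction i using Fin.induction with
  | zero =>
    have := D.F0
    exact ⟨_, isGoodCover_const_one⟩
  | succ i ih =>
    obtain ⟨p, hp⟩ := ih
    obtain ⟨p', hp'⟩ := MappingCone.exists_isGoodCover (D.h i) hp
    exact ⟨_, hp'.comp_homeomorph (D.cone i)⟩

section Product

variable {X Y : Type u} [TopologicalSpace X] [TopologicalSpace Y]

/-- The products of two families of functions. -/
def prodPiece (p : ℕ → C(X, ℝ)) (q : ℕ → C(Y, ℝ)) (x : ℕ × ℕ) : C(X × Y, ℝ) :=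
  ⟨fun w => p x.1 w.1 * q x.2 w.2, by fun_prop⟩

/-- A function positive on the `k`-th stage of the product filtration. -/
def prodStage (p : ℕ → C(X, ℝ)) (q : ℕ → C(Y, ℝ)) (k : ℕ) : C(X × Y, ℝ) :=
  ⟨fun w => ∑ l ∈ Finset.range (k + 1),
    ∑ x ∈ Finset.HasAntidiagonal.antidiagonal l, prodPiece p q x w, by fun_prop⟩

variable {p : ℕ → C(X, ℝ)} {q : ℕ → C(Y, ℝ)} {m n : ℕ}

theorem prodPiece_nonneg (hp : IsGoodCover p m) (hq : IsGoodCover q n) (x : ℕ × ℕ) (w : X × Y) :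
    0 ≤ prodPiece p q x w :=
  mul_nonneg (hp.nonneg _ _) (hq.nonneg _ _)

theorem prodPiece_pos_iff (hp : IsGoodCover p m) (hq : IsGoodCover q n) (x : ℕ × ℕ) (w : X × Y) :
    0 < prodPiece p q x w ↔ 0 < p x.1 w.1 ∧ 0 < q x.2 w.2 :=
  ⟨fun h => ⟨pos_of_mul_pos_left h (hq.nonneg _ _), pos_of_mul_pos_right h (hp.nonneg _ _)⟩,
    fun h => mul_pos h.1 h.2⟩

theorem prodStage_apply (p : ℕ → C(X, ℝ)) (q : ℕ → C(Y, ℝ)) (k : ℕ) (w : X × Y) :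
    prodStage p q k w = ∑ l ∈ Finset.range (k + 1),
      ∑ x ∈ Finset.HasAntidiagonal.antidiagonal l, prodPiece p q x w :=
  rfl

theorem prodStage_nonneg (hp : IsGoodCover p m) (hq : IsGoodCover q n) (k : ℕ) (w : X × Y) :
    0 ≤ prodStage p q k w := by
  rw [prodStage_apply]
  exact Finset.sum_nonneg fun _ _ => Finset.sum_nonneg fun x _ => prodPiece_nonneg hp hq x w

theorem prodStage_pos_iff (hp : IsGoodCover p m) (hq : IsGoodCover q n) (k : ℕ) (w : X × Y) :
    0 < prodStage p q k w ↔ ∃ x : ℕ × ℕ, x.1 + x.2 ≤ k ∧ 0 < prodPiece p q x w := by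
  have h0 := prodPiece_nonneg hp hq
  rw [prodStage_apply]
  refine (Finset.sum_pos_iff_of_nonneg fun l _ => Finset.sum_nonneg fun x _ => h0 x w).trans ?_
  simp_rw [Finset.sum_pos_iff_of_nonneg fun x _ => h0 x w]
  constructor
  · rintro ⟨l, hl, x, hx, h⟩
    exact ⟨x, (Finset.HasAntidiagonal.mem_antidiagonal.1 hx).trans_le
      (Nat.lt_succ_iff.1 (Finset.mem_range.1 hl)), h⟩
  · rintro ⟨x, hx, h⟩
    exact ⟨x.1 + x.2, Finset.mem_range.2 (Nat.lt_succ_of_le hx), x, by simp, h⟩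

theorem contractibleSpace_prodPiece (hp : IsGoodCover p m) (hq : IsGoodCover q n) (x : ℕ × ℕ)
    (h : ∃ w, 0 < prodPiece p q x w) : ContractibleSpace {w // 0 < prodPiece p q x w} := by
  obtain ⟨w, hw⟩ := h
  rw [prodPiece_pos_iff hp hq] at hw
  have := hp.contractible x.1 ⟨_, hw.1⟩
  have := hq.contractible x.2 ⟨_, hw.2⟩
  have e : {w // 0 < prodPiece p q x w} ≃ₜ {a // 0 < p x.1 a} × {b // 0 < q x.2 b} :=
    { toFun := fun w => (⟨w.1.1, ((prodPiece_pos_iff hp hq x w.1).1 w.2).1⟩,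
        ⟨w.1.2, ((prodPiece_pos_iff hp hq x w.1).1 w.2).2⟩)
      invFun := fun w => ⟨(w.1, w.2), (prodPiece_pos_iff hp hq x _).2 ⟨w.1.2, w.2.2⟩⟩
      left_inv := fun w => rfl
      right_inv := fun w => rfl
      continuous_toFun := by fun_prop
      continuous_invFun := by fun_prop }
  exact e.contractibleSpace

theorem exists_prodPiece_pos_of_lt (hp : IsGoodCover p m) (hq : IsGoodCover q n) (x : ℕ × ℕ)
    (hx : x.1 + x.2 ≠ 0) (h : ∃ w, 0 < prodPiece p q x w) :
    ∃ w, 0 < prodPiece p q x w ∧ ∃ y : ℕ × ℕ, y.1 + y.2 < x.1 + x.2 ∧ 0 < prodPiece p q y w := by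
  obtain ⟨w, hw⟩ := h
  simp only [prodPiece_pos_iff hp hq] at hw ⊢
  by_cases h1 : x.1 = 0
  · obtain ⟨b, hb, j, hj, hb'⟩ := hq.meets x.2 (by omega) ⟨_, hw.2⟩
    exact ⟨(w.1, b), ⟨hw.1, hb⟩, (x.1, j), by dsimp only; omega, hw.1, hb'⟩
  · obtain ⟨a, ha, i, hi, ha'⟩ := hp.meets x.1 h1 ⟨_, hw.1⟩
    exact ⟨(a, w.2), ⟨ha, hw.2⟩, (i, x.2), by dsimp only; omega, ha', hw.2⟩

theorem pathConnectedSpace_prodStage (hp : IsGoodCover p m) (hq : IsGoodCover q n) (k : ℕ) :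
    PathConnectedSpace {w // 0 < prodStage p q k w} := by
  obtain ⟨a, ha⟩ := hp.zero_nonempty
  obtain ⟨b, hb⟩ := hq.zero_nonempty
  have hpc : ∀ x : ℕ × ℕ, x.1 + x.2 ≤ k → ∀ v w, 0 < prodPiece p q x v → 0 < prodPiece p q x w →
      JoinedIn {w | 0 < prodStage p q k w} v w := by
    intro x hx v w hv hw
    have := contractibleSpace_prodPiece hp hq x ⟨v, hv⟩
    have h : IsPathConnected {w | 0 < prodPiece p q x w} :=
      isPathConnected_iff_pathConnectedSpace.2 (inferInstanceAs
        (PathConnectedSpace {w // 0 < prodPiece p q x w}))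
    exact (h.joinedIn v hv w hw).mono fun u hu => (prodStage_pos_iff hp hq k u).2 ⟨x, hx, hu⟩
  have key : ∀ l ≤ k, ∀ x : ℕ × ℕ, x.1 + x.2 = l → ∀ w, 0 < prodPiece p q x w →
      JoinedIn {w | 0 < prodStage p q k w} (a, b) w := by
    intro l
    induction l using Nat.strong_induction_on with
    | _ l ih =>
      intro hl x hx w hw
      by_cases hx0 : x.1 + x.2 = 0
      · refine hpc x (hx.trans_le hl) _ _ ?_ hw
        rw [prodPiece_pos_iff hp hq, show x.1 = 0 by omega, show x.2 = 0 by omega]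
        exact ⟨ha, hb⟩
      · obtain ⟨v, hv, y, hy, hv'⟩ := exists_prodPiece_pos_of_lt hp hq x hx0 ⟨w, hw⟩
        exact (ih _ (by omega) (by omega) y rfl v hv').trans (hpc x (hx.trans_le hl) v w hv hw)
  have : IsPathConnected {w | 0 < prodStage p q k w} := by
    refine ⟨(a, b), ?_, fun w hw => ?_⟩
    · exact (prodStage_pos_iff hp hq k _).2 ⟨(0, 0), Nat.zero_le _,
        (prodPiece_pos_iff hp hq _ _).2 ⟨ha, hb⟩⟩
    · obtain ⟨x, hx, h⟩ := (prodStage_pos_iff hp hq k _).1 hw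
      exact key _ hx x rfl _ h
  exact isPathConnected_iff_pathConnectedSpace.1 this

theorem exists_prodStage_succ_homotopyEquiv (hp : IsGoodCover p m) (hq : IsGoodCover q n) (k : ℕ) :
    ∃ (K : TopCat.{u}) (f : C(K, {w // 0 < prodStage p q k w})),
      Nonempty ({w // 0 < prodStage p q (k + 1) w} ≃ₕ MappingCone f) := by
  let ι := {x : Finset.HasAntidiagonal.antidiagonal (k + 1) // ∃ w, 0 < prodPiece p q x w}
  have : Fintype ι := Fintype.ofFinite ι
  have := pathConnectedSpace_prodStage hp hq k
  have : ∀ a : ι, ContractibleSpace {w // 0 < prodPiece p q a.1 w} := fun a =>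
    contractibleSpace_prodPiece hp hq _ a.2
  have hsum : ∀ a : ι, a.1.1.1 + a.1.1.2 = k + 1 := fun a =>
    Finset.HasAntidiagonal.mem_antidiagonal.1 a.1.2
  have hlt : ∀ a b : ι, a.1.1.1 < b.1.1.1 → ∀ w, 0 < prodPiece p q a.1 w →
      0 < prodPiece p q b.1 w → 0 < prodStage p q k w := by
    intro a b hab w ha hb
    rw [prodPiece_pos_iff hp hq] at ha hb
    refine (prodStage_pos_iff hp hq k w).2 ⟨(a.1.1.1, b.1.1.2), ?_,
      (prodPiece_pos_iff hp hq _ _).2 ⟨ha.1, hb.2⟩⟩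
    have := hsum b
    dsimp only
    omega
  obtain ⟨K, f, ⟨e⟩⟩ := exists_homotopyEquiv_mappingCone (prodStage p q k)
    (fun a : ι => prodPiece p q a.1) (prodStage_nonneg hp hq k)
    (fun a => prodPiece_nonneg hp hq _) (fun a b hab w ha hb => by
      rcases lt_trichotomy a.1.1.1 b.1.1.1 with h | h | h
      · exact hlt a b h w ha hb
      · refine (hab (Subtype.ext (Subtype.ext (Prod.ext h ?_)))).elim
        have := hsum a
        have := hsum b
        omega
      · exact hlt b a h w hb ha) (fun a => by
      have := hsum a
      obtain ⟨w, hw, y, hy, hw'⟩ := exists_prodPiece_pos_of_lt hp hq a.1 (by omega) a.2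
      exact ⟨w, hw, (prodStage_pos_iff hp hq k w).2 ⟨y, by omega, hw'⟩⟩)
  have e' : {w // 0 < prodStage p q (k + 1) w} ≃ₜ
      {w // 0 < prodStage p q k w ∨ ∃ a : ι, 0 < prodPiece p q a.1 w} := by
    refine (Homeomorph.refl _).subtype fun w => ?_
    change 0 < prodStage p q (k + 1) w ↔ 0 < prodStage p q k w ∨ ∃ a : ι, 0 < prodPiece p q a.1 w
    rw [prodStage_pos_iff hp hq, prodStage_pos_iff hp hq]
    constructor
    · rintro ⟨x, hx, h⟩
      rcases Nat.le_succ_iff.1 hx with hx | hx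
      · exact Or.inl ⟨x, hx, h⟩
      · exact Or.inr ⟨⟨⟨x, Finset.HasAntidiagonal.mem_antidiagonal.2 hx⟩, w, h⟩, h⟩
    · rintro (⟨x, hx, h⟩ | ⟨a, h⟩)
      · exact ⟨x, by omega, h⟩
      · exact ⟨a.1, (hsum a).le, h⟩
  exact ⟨K, f, ⟨e'.toHomotopyEquiv.trans e⟩⟩

theorem contractibleSpace_prodStage_zero (hp : IsGoodCover p m) (hq : IsGoodCover q n) :
    ContractibleSpace {w // 0 < prodStage p q 0 w} := by
  obtain ⟨a, ha⟩ := hp.zero_nonempty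
  obtain ⟨b, hb⟩ := hq.zero_nonempty
  have := contractibleSpace_prodPiece hp hq (0, 0) ⟨(a, b), mul_pos ha hb⟩
  have e : {w // 0 < prodStage p q 0 w} ≃ₜ {w // 0 < prodPiece p q (0, 0) w} :=
    (Homeomorph.refl _).subtype fun w => by simp [prodStage]
  exact e.contractibleSpace

theorem prodStage_add_pos (hp : IsGoodCover p m) (hq : IsGoodCover q n) (w : X × Y) :
    0 < prodStage p q (m + n) w := by
  obtain ⟨i, hi, ha⟩ := hp.exists_pos w.1
  obtain ⟨j, hj, hb⟩ := hq.exists_pos w.2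
  exact (prodStage_pos_iff hp hq _ _).2 ⟨(i, j), Nat.add_le_add hi hj, mul_pos ha hb⟩

end Product

/-- A sequence of spaces each of which is up to homotopy a mapping cone over the preceding one
yields a cone-decomposition. -/
theorem nonempty_coneDecomp (O K : ℕ → TopCat.{u}) (f : ∀ k, C(K k, O k))
    (e : ∀ k, Nonempty (O (k + 1) ≃ₕ MappingCone (f k))) [ContractibleSpace (O 0)] (N : ℕ) :
    Nonempty (ConeDecomp (O N) N) := by
  let T : ∀ k, Σ F : TopCat.{u}, F ≃ₕ O k := fun k => Nat.rec
    ⟨TopCat.of PUnit, (ContractibleSpace.hequiv PUnit (O 0)).some⟩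
    (fun k T => ⟨TopCat.of (MappingCone (T.2.symm.toFun.comp (f k))),
      (MappingCone.nonempty_homotopyEquiv_comp (f k) T.2.symm).some.symm.trans (e k).some.symm⟩) k
  exact ⟨{
    F := fun i => (T i).1
    K := fun i => K i
    h := fun i => (T i).2.symm.toFun.comp (f i)
    F0 := (⟨⟨PUnit.unit⟩, fun _ => rfl⟩ : Unique PUnit)
    cone := fun i => Homeomorph.refl (MappingCone ((T i).2.symm.toFun.comp (f i)))
    equiv := (T N).2 }⟩

/-- If `X` has a cone-decomposition of length `m` and `Y` one of length `n`, then `X × Y`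
has a cone-decomposition of length `m + n`; in particular `Cat(X × Y) ≤ Cat(X) + Cat(Y)`. -/
theorem coneDecomp_prod {X Y : Type u} [TopologicalSpace X] [TopologicalSpace Y]
    {m n : ℕ} (DX : ConeDecomp X m) (DY : ConeDecomp Y n) :
    Nonempty (ConeDecomp (X × Y) (m + n)) := by
  obtain ⟨p, hp⟩ := DX.exists_isGoodCover
  obtain ⟨q, hq⟩ := DY.exists_isGoodCover
  choose K f e using exists_prodStage_succ_homotopyEquiv hp hq
  have := contractibleSpace_prodStage_zero hp hq
  obtain ⟨D⟩ := nonempty_coneDecomp (fun k => TopCat.of {w // 0 < prodStage p q k w}) K f e (m + n)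
  have e' : {w // 0 < prodStage p q (m + n) w} ≃ₜ DX.F (Fin.last m) × DY.F (Fin.last n) :=
    { toFun := Subtype.val
      invFun := fun w => ⟨w, prodStage_add_pos hp hq w⟩
      left_inv := fun w => rfl
      right_inv := fun w => rfl }
  exact ⟨{ D with
    equiv := (D.equiv.trans e'.toHomotopyEquiv).trans (DX.equiv.prodCongr DY.equiv) }⟩
end

section
/- Let F → E → B be a fibration, and let E' = E ∪ CF be obtained by coning off the fibre, with induced map φ: E' → B (Ganea's fibre–cofibre construction). Then the homotopy fibre of φ is homotopy equivalent to the join F * ΩB. -/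
/-!
STATEMENT 16: Let F → E → B be a fibration and E' = E ∪ CF obtained by coning off the
fibre, with the induced map φ : E' → B (Ganea's fibre–cofibre construction).  Then the
homotopy fibre of φ is homotopy equivalent to the join F * ΩB.
-/

universe u

noncomputable section

/-- `p : E → B` is a (Hurewicz) fibration: it has the homotopy lifting property with
respect to all spaces. -/
def IsFibration {E B : Type u} [TopologicalSpace E] [TopologicalSpace B]
    (p : C(E, B)) : Prop :=
  ∀ (Z : Type u) [TopologicalSpace Z] (f : C(Z, E)) (H : C(Z × unitInterval, B)),
    (∀ z, H (z, 0) = p (f z)) →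
    ∃ H' : C(Z × unitInterval, E),
      (∀ z t, p (H' (z, t)) = H (z, t)) ∧ ∀ z, H' (z, 0) = f z

/-- The relation defining the join `Z * W`. -/
inductive JoinRel (Z W : Type u) :
    Z × W × unitInterval → Z × W × unitInterval → Prop
  | bot (z : Z) (w w' : W) : JoinRel Z W (z, w, 0) (z, w', 0)
  | top (z z' : Z) (w : W) : JoinRel Z W (z, w, 1) (z', w, 1)

/-- The join `Z * W`. -/
abbrev Join (Z W : Type u) : Type u := Quot (JoinRel Z W)

/-- The loop space `ΩB` at `b0`. -/
def LoopS (B : Type u) [TopologicalSpace B] (b0 : B) : Type u :=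
  {γ : C(unitInterval, B) // γ 0 = b0 ∧ γ 1 = b0}

instance (B : Type u) [TopologicalSpace B] (b0 : B) : TopologicalSpace (LoopS B b0) :=
  instTopologicalSpaceSubtype

variable {E B : Type u} [TopologicalSpace E] [TopologicalSpace B]

/-- The fibre `F = p⁻¹(b0)` of `p : E → B`. -/
def Fibre (p : C(E, B)) (b0 : B) : Type u := {e : E // p e = b0}

instance (p : C(E, B)) (b0 : B) : TopologicalSpace (Fibre p b0) :=
  instTopologicalSpaceSubtype

/-- The fibre–cofibre construction `E' = E ∪ CF`: the mapping cone of the inclusion of the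
fibre `F = p⁻¹(b0)` into `E`. -/
abbrev FibreCofibre (p : C(E, B)) (b0 : B) : Type u :=
  MappingCone (Subtype.val : Fibre p b0 → E)

/-- The induced map `φ : E' = E ∪ CF → B`, extending `p` by sending the cone to `b0`. -/
def fibreCofibreMap (p : C(E, B)) (b0 : B) : FibreCofibre p b0 → B :=
  Quot.lift (Sum.elim (fun _ => b0) ⇑p) (by
    rintro _ _ (⟨k⟩ | ⟨k, k'⟩)
    · exact (k.2).symm
    · rfl)

/-- The homotopy fibre over `b0` of a map `φ : E' → B`. -/
def HoFib {E' : Type u} [TopologicalSpace E'] (φ : E' → B) (b0 : B) : Type u :=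
  {q : E' × C(unitInterval, B) // q.2 0 = φ q.1 ∧ q.2 1 = b0}

instance {E' : Type u} [TopologicalSpace E'] (φ : E' → B) (b0 : B) :
    TopologicalSpace (HoFib φ b0) := instTopologicalSpaceSubtype

open Topology unitInterval

/-- A homotopy between maps out of a quotient, given by a homotopy upstairs. -/
theorem homotopic_of_quot {A Y : Type*} [TopologicalSpace A] [TopologicalSpace Y]
    {r : A → A → Prop} {f g : C(Quot r, Y)} (H : A × I → Y) (hc : Continuous H)
    (hr : ∀ a b, r a b → ∀ t, H (a, t) = H (b, t))
    (h0 : ∀ a, H (a, 0) = f (Quot.mk r a)) (h1 : ∀ a, H (a, 1) = g (Quot.mk r a)) :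
    f.Homotopic g := by
  let G : Quot r × I → Y := fun q => Quot.lift (fun a => H (a, q.2)) (fun a b h => hr a b h q.2) q.1
  have hG : Continuous G := isQuotientMap_quot_mk.continuous_lift_prod_left hc
  have hf : ∀ q, G (q, 0) = f q := by rintro ⟨a⟩; exact h0 a
  have hg : ∀ q, G (q, 1) = g q := by rintro ⟨a⟩; exact h1 a
  exact ⟨{ toFun := fun q => G (q.2, q.1)
           continuous_toFun := hG.comp continuous_swap
           map_zero_left := hf
           map_one_left := hg }⟩

/-- Continuity on the product of a binary sum with a space is checked on the summands. -/
theorem continuous_sum_prod {A A' T Y : Type*} [TopologicalSpace A] [TopologicalSpace A']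
    [TopologicalSpace T] [TopologicalSpace Y] {H : (A ⊕ A') × T → Y}
    (h : Continuous fun q : A × T => H (Sum.inl q.1, q.2))
    (h' : Continuous fun q : A' × T => H (Sum.inr q.1, q.2)) : Continuous H := by
  exact (Homeomorph.sumProdDistrib (X := A) (Y := A') (Z := T)).symm.comp_continuous_iff'.1
    (continuous_sum_dom.2 ⟨h, h'⟩)

/-- Truncation of a real number to the unit interval. -/
def clamp (x : ℝ) : I := Set.projIcc 0 1 zero_le_one x

@[fun_prop]
theorem continuous_clamp : Continuous clamp := continuous_projIcc (h := zero_le_one)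

theorem clamp_of_le_zero {x : ℝ} (h : x ≤ 0) : clamp x = 0 := Set.projIcc_of_le_left _ h

theorem clamp_of_one_le {x : ℝ} (h : 1 ≤ x) : clamp x = 1 := Set.projIcc_of_right_le _ h

@[simp]
theorem clamp_coe (x : I) : clamp x = x := Set.projIcc_val _ x

section Cylinder

variable {F W N : Type u}

/-- The gluing relation for the double mapping cylinder of `N ← F × W → W`. -/
inductive CylRel (j : F × W → N) : (F × W × I) ⊕ N → (F × W × I) ⊕ N → Prop
  | glue (f : F) (w : W) : CylRel j (Sum.inl (f, w, 1)) (Sum.inr (j (f, w)))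
  | apex (f f' : F) (w : W) : CylRel j (Sum.inl (f, w, 0)) (Sum.inl (f', w, 0))

/-- The double mapping cylinder of `N ← F × W → W`. -/
abbrev Cyl (j : F × W → N) : Type u := Quot (CylRel j)

/-- The inclusion of the cylinder part. -/
def Cyl.inl (j : F × W → N) (x : F × W × I) : Cyl j := Quot.mk _ (Sum.inl x)

/-- The inclusion of the end `N`. -/
def Cyl.inr (j : F × W → N) (n : N) : Cyl j := Quot.mk _ (Sum.inr n)

theorem Cyl.inl_one (j : F × W → N) (f : F) (w : W) :
    Cyl.inl j (f, w, 1) = Cyl.inr j (j (f, w)) := Quot.sound (.glue f w)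

theorem Cyl.inl_zero (j : F × W → N) (f f' : F) (w : W) :
    Cyl.inl j (f, w, 0) = Cyl.inl j (f', w, 0) := Quot.sound (.apex f f' w)

/-- The point of the double mapping cylinder that, as `s` grows from `0` to `1 / 2`, moves
along the cylinder line through `(f, w)`, and is `n` afterwards. -/
def Cyl.glued (j : F × W → N) (s : ℝ) (f : F) (w : W) (n : N) : Cyl j :=
  if s ≤ 1 / 2 then Cyl.inl j (f, w, clamp (2 * s)) else Cyl.inr j n

theorem Cyl.glued_of_le {j : F × W → N} {s : ℝ} {f : F} {w : W} {n : N} (h : s ≤ 1 / 2) :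
    Cyl.glued j s f w n = Cyl.inl j (f, w, clamp (2 * s)) := if_pos h

theorem Cyl.glued_of_lt {j : F × W → N} {s : ℝ} {f : F} {w : W} {n : N} (h : 1 / 2 < s) :
    Cyl.glued j s f w n = Cyl.inr j n := if_neg h.not_ge

/-- The inclusion of the cylinder part of a join. -/
def Join.mk (z : F) (w : W) (t : I) : Join F W := Quot.mk _ (z, w, t)

theorem Join.mk_zero (z : F) (w w' : W) : Join.mk z w 0 = Join.mk z w' 0 :=
  Quot.sound (.bot z w w')

theorem Join.mk_one (z z' : F) (w : W) : Join.mk z w 1 = Join.mk z' w 1 :=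
  Quot.sound (.top z z' w)

variable [TopologicalSpace F] [TopologicalSpace W] [TopologicalSpace N]

@[fun_prop]
theorem Cyl.continuous_inl (j : F × W → N) : Continuous (Cyl.inl j) :=
  continuous_quot_mk.comp _root_.continuous_inl

@[fun_prop]
theorem Cyl.continuous_inr (j : F × W → N) : Continuous (Cyl.inr j) :=
  continuous_quot_mk.comp _root_.continuous_inr

theorem Cyl.continuous_glued {Z : Type*} [TopologicalSpace Z] {j : F × W → N} {s : Z → ℝ}
    {f : Z → F} {w : Z → W} {n : Z → N} (hs : Continuous s) (hf : Continuous f)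
    (hw : Continuous w) (hn : Continuous n)
    (h : ∀ z, s z = 1 / 2 → n z = j (f z, w z)) :
    Continuous fun z => Cyl.glued j (s z) (f z) (w z) (n z) := by
  refine Continuous.if_le (by fun_prop) (by fun_prop) hs continuous_const fun z hz => ?_
  rw [h z hz, clamp_of_one_le (by linarith), Cyl.inl_one]

theorem Join.continuous_mk : Continuous fun x : F × W × I => Join.mk x.1 x.2.1 x.2.2 :=
  continuous_quot_mk

/-- The double mapping cylinder of `N ← F × W → W` is a join `F * W`, as soon as `N` is
homotopy equivalent to `F` in such a way that `j` becomes a shear map. -/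
theorem cyl_homotopyEquiv_join (j : C(F × W, N)) (i : C(F, N)) (τ : C(N, F))
    (K : C(N × I, N)) (k : C(F × I, F)) (ψ : C(F × W, F)) (M : C(F × W × I, N))
    (β : C(F × W × I, F)) (Q : C(F × W × I × I, N)) (w₀ : W)
    (hK0 : ∀ n, K (n, 0) = n) (hK1 : ∀ n, K (n, 1) = i (τ n))
    (hk0 : ∀ f, k (f, 0) = f) (hk1 : ∀ f, k (f, 1) = τ (i f))
    (hM0 : ∀ f w, M (f, w, 0) = i f) (hM1 : ∀ f w, M (f, w, 1) = j (ψ (f, w), w))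
    (hQ_zero : ∀ f w r, Q (f, w, r, 0) = K (j (f, w), r))
    (hQ_one : ∀ f w r, Q (f, w, r, 1) = j (β (f, w, r), w))
    (hQ1 : ∀ f w s, Q (f, w, 1, s) = M (τ (j (f, w)), w, s))
    (hβ1 : ∀ f w, β (f, w, 1) = ψ (τ (j (f, w)), w))
    (hQ0 : ∀ f w s, Q (f, w, 0, s) = j (k (f, s), w))
    (hβ0 : ∀ f w, β (f, w, 0) = k (f, 1)) :
    Nonempty (ContinuousMap.HomotopyEquiv (Cyl j) (Join F W)) := by
  let Φ : C(Cyl j, Join F W) :=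
    ⟨Quot.lift (Sum.elim (fun x => Join.mk (τ (j (x.1, x.2.1))) x.2.1 (σ x.2.2))
        (fun n => Join.mk (τ n) w₀ 0)) (by
          rintro _ _ (⟨f, w⟩ | ⟨f, f', w⟩)
          · simpa using Join.mk_zero _ _ _
          · simpa using Join.mk_one _ _ _),
      continuous_quot_lift _ (continuous_sum_dom.2
        ⟨Join.continuous_mk.comp
            (by fun_prop : Continuous fun x : F × W × I => (τ (j (x.1, x.2.1)), x.2.1, σ x.2.2)),
          Join.continuous_mk.comp
            (by fun_prop : Continuous fun n : N => (τ n, w₀, (0 : I)))⟩)⟩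
  let Ψ : C(Join F W, Cyl j) :=
    ⟨Quot.lift (fun x => Cyl.glued j (1 - x.2.2) (ψ (x.1, x.2.1)) x.2.1
        (M (x.1, x.2.1, clamp (2 * x.2.2)))) (by
          rintro _ _ (⟨f, w, w'⟩ | ⟨f, f', w⟩)
          · rw [Cyl.glued_of_lt (by norm_num), Cyl.glued_of_lt (by norm_num)]
            simp [clamp_of_le_zero, hM0]
          · rw [Cyl.glued_of_le (by norm_num), Cyl.glued_of_le (by norm_num)]
            simpa [clamp_of_le_zero] using Cyl.inl_zero _ _ _ _),
      continuous_quot_lift _ (Cyl.continuous_glued (by fun_prop) (by fun_prop) (by fun_prop)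
        (by fun_prop) (by
          rintro ⟨f, w, t⟩ h
          simp only at h ⊢
          rw [clamp_of_one_le (by linarith), hM1]))⟩
  have hΦl : ∀ f w s, Φ (Cyl.inl j (f, w, s)) = Join.mk (τ (j (f, w))) w (σ s) :=
    fun _ _ _ => rfl
  have hΦr : ∀ n, Φ (Cyl.inr j n) = Join.mk (τ n) w₀ 0 := fun _ => rfl
  have hΨ : ∀ f w t, Ψ (Join.mk f w t) = Cyl.glued j (1 - t) (ψ (f, w)) w
    (M (f, w, clamp (2 * t))) := fun _ _ _ => rfl
  -- `θ` preserves the cylinder lines up to a move in `F` that contracts to the identity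
  let θ : C(Cyl j, Cyl j) :=
    ⟨Quot.lift (Sum.elim (fun x => Cyl.inl j (k (x.1, clamp (2 - 2 * x.2.2)), x.2.1,
        clamp (2 * x.2.2))) (Cyl.inr j)) (by
          rintro _ _ (⟨f, w⟩ | ⟨f, f', w⟩)
          · simpa [clamp_of_le_zero, clamp_of_one_le, hk0] using Cyl.inl_one _ _ _
          · simpa [clamp_of_le_zero] using Cyl.inl_zero _ _ _ _),
      continuous_quot_lift _ (continuous_sum_dom.2 ⟨by
        simp only [Function.comp_def, Sum.elim_inl]; fun_prop, by
        simp only [Function.comp_def, Sum.elim_inr]; fun_prop⟩)⟩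
  have hθ1 : θ.Homotopic (Ψ.comp Φ) := by
    refine homotopic_of_quot
      (fun q => Sum.elim (fun x => Cyl.glued j x.2.2 (β (x.1, x.2.1, q.2)) x.2.1
        (Q (x.1, x.2.1, q.2, clamp (2 - 2 * x.2.2)))) (fun n => Cyl.inr j (K (n, q.2))) q.1)
      ?_ ?_ ?_ ?_
    · refine continuous_sum_prod (Cyl.continuous_glued (by fun_prop) (by fun_prop) (by fun_prop)
        (by fun_prop) ?_) ((Cyl.continuous_inr j).comp K.continuous)
      rintro ⟨⟨f, w, s⟩, t⟩ h
      simp only at h ⊢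
      rw [clamp_of_one_le (by linarith), hQ_one]
    · rintro _ _ (⟨f, w⟩ | ⟨f, f', w⟩) t
      · simp only [Sum.elim_inl, Sum.elim_inr]
        rw [Cyl.glued_of_lt (by norm_num), clamp_of_le_zero (by norm_num), hQ_zero]
      · simp only [Sum.elim_inl]
        rw [Cyl.glued_of_le (by norm_num), Cyl.glued_of_le (by norm_num)]
        simpa [clamp_of_le_zero] using Cyl.inl_zero _ _ _ _
    · rintro (⟨f, w, s⟩ | n)
      · change _ = Cyl.inl j (k (f, clamp (2 - 2 * s)), w, clamp (2 * s))
        simp only [Sum.elim_inl]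
        rcases le_or_gt (s : ℝ) (1 / 2) with h | h
        · rw [Cyl.glued_of_le h, hβ0, clamp_of_one_le (x := 2 - 2 * (s : ℝ)) (by linarith)]
        · rw [Cyl.glued_of_lt h, hQ0, clamp_of_one_le (x := 2 * (s : ℝ)) (by linarith),
            Cyl.inl_one]
      · simp only [Sum.elim_inr, hK0]; rfl
    · rintro (⟨f, w, s⟩ | n)
      · change _ = Ψ (Φ (Cyl.inl j (f, w, s)))
        simp only [Sum.elim_inl, hΦl, hΨ, hβ1, hQ1, unitInterval.coe_symm_eq, sub_sub_cancel,
          mul_sub, mul_one]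
      · change _ = Ψ (Φ (Cyl.inr j n))
        rw [hΦr, hΨ, Cyl.glued_of_lt (by norm_num), clamp_of_le_zero (by norm_num), hM0]
        simp [hK1]
  have hθ0 : (ContinuousMap.id _).Homotopic θ := by
    refine homotopic_of_quot
      (fun q => Sum.elim (fun x => Cyl.inl j (k (x.1, clamp (q.2 * (clamp (2 - 2 * x.2.2) : ℝ))),
        x.2.1, clamp ((1 + q.2) * x.2.2))) (Cyl.inr j) q.1) ?_ ?_ ?_ ?_
    · exact continuous_sum_prod (by simp only [Sum.elim_inl]; fun_prop)
        (by simp only [Sum.elim_inr]; fun_prop)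
    · rintro _ _ (⟨f, w⟩ | ⟨f, f', w⟩) t
      · simp only [Sum.elim_inl, Sum.elim_inr]
        rw [clamp_of_le_zero (x := 2 - 2 * _) (by norm_num), clamp_of_le_zero (by norm_num), hk0,
          clamp_of_one_le (by have := t.2.1; norm_num; exact this), Cyl.inl_one]
      · simpa [clamp_of_le_zero] using Cyl.inl_zero _ _ _ _
    · rintro (⟨f, w, s⟩ | n)
      · simp [clamp_of_le_zero, hk0]; rfl
      · rfl
    · rintro (⟨f, w, s⟩ | n)
      · change _ = Cyl.inl j (k (f, clamp (2 - 2 * s)), w, clamp (2 * s))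
        simp [one_add_one_eq_two]
      · rfl
  let χ : C(Join F W, Join F W) :=
    ⟨Quot.lift (fun x => Join.mk (τ (i x.1)) x.2.1 x.2.2) (by
          rintro _ _ (⟨f, w, w'⟩ | ⟨f, f', w⟩)
          · exact Join.mk_zero _ _ _
          · exact Join.mk_one _ _ _),
      continuous_quot_lift _ (Join.continuous_mk.comp
            (by fun_prop : Continuous fun x : F × W × I => (τ (i x.1), x.2.1, x.2.2)))⟩
  have hχ0 : (ContinuousMap.id _).Homotopic χ := by
    refine homotopic_of_quot (fun q => Join.mk (k (q.1.1, q.2)) q.1.2.1 q.1.2.2) ?_ ?_ ?_ ?_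
    · exact Join.continuous_mk.comp
        (by fun_prop : Continuous fun q : (F × W × I) × I => (k (q.1.1, q.2), q.1.2.1, q.1.2.2))
    · rintro _ _ (⟨f, w, w'⟩ | ⟨f, f', w⟩) t
      · exact Join.mk_zero _ _ _
      · exact Join.mk_one _ _ _
    · rintro ⟨f, w, t⟩
      simp only [hk0]; rfl
    · rintro ⟨f, w, t⟩
      simp only [hk1]; rfl
  have hχ1 : χ.Homotopic (Φ.comp Ψ) := by
    refine homotopic_of_quot (fun q => Join.mk
      (τ (M (q.1.1, q.1.2.1, clamp (q.2 * (clamp (2 * q.1.2.2) : ℝ))))) q.1.2.1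
      (clamp ((1 + q.2) * q.1.2.2 - q.2))) ?_ ?_ ?_ ?_
    · exact Join.continuous_mk.comp
        (by fun_prop : Continuous fun q : (F × W × I) × I =>
          (τ (M (q.1.1, q.1.2.1, clamp (q.2 * (clamp (2 * q.1.2.2) : ℝ)))), q.1.2.1,
            clamp ((1 + q.2) * q.1.2.2 - q.2)))
    · rintro _ _ (⟨f, w, w'⟩ | ⟨f, f', w⟩) t
      · simp only
        rw [clamp_of_le_zero (x := 2 * _) (by norm_num), clamp_of_le_zero (by norm_num),
          clamp_of_le_zero (by have := t.2.1; norm_num; exact this), hM0, hM0]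
        exact Join.mk_zero _ _ _
      · simp only
        rw [clamp_of_one_le (x := _ - _) (by norm_num)]
        exact Join.mk_one _ _ _
    · rintro ⟨f, w, t⟩
      simp [clamp_of_le_zero, hM0]; rfl
    · rintro ⟨f, w, t⟩
      change _ = Φ (Ψ (Join.mk f w t))
      rw [hΨ]
      rcases le_or_gt (1 - t : ℝ) (1 / 2) with h | h
      · rw [Cyl.glued_of_le h, hΦl]
        have h2 : clamp (2 * t) = 1 := clamp_of_one_le (by linarith)
        have h3 : clamp ((1 + 1) * t - 1 : ℝ) = σ (clamp (2 * (1 - t))) := by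
          have hm : 2 * (1 - t : ℝ) ∈ I := ⟨by linarith [t.2.2], by linarith⟩
          rw [show clamp (2 * (1 - t : ℝ)) = ⟨_, hm⟩ from clamp_coe ⟨_, hm⟩, ← clamp_coe (σ _)]
          congr 1
          simp only [unitInterval.coe_symm_eq]
          ring
        simp [h2, clamp_of_one_le, hM1, h3]
      · rw [Cyl.glued_of_lt h, hΦr]
        simp only [Set.Icc.coe_one, one_mul, clamp_coe]
        rw [clamp_of_le_zero (x := _ - _) (by linarith)]
        exact Join.mk_zero _ _ _
  exact ⟨⟨Φ, Ψ, (hθ0.trans hθ1).symm, (hχ0.trans hχ1).symm⟩⟩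

end Cylinder

section Ganea

variable {p : C(E, B)} {b₀ : B}

/-- The inclusion into the homotopy fibre of `p` of the fibre, with loops as paths. -/
def fibreLoop (p : C(E, B)) (b₀ : B) : C(Fibre p b₀ × LoopS B b₀, HoFib p b₀) where
  toFun x := ⟨(x.1.1, x.2.1), x.2.2.1.trans x.1.2.symm, x.2.2.2⟩
  continuous_toFun := Continuous.subtype_mk (Continuous.prodMk
    (continuous_subtype_val.comp continuous_fst) (continuous_subtype_val.comp continuous_snd)) _

/-- The final part `t ↦ γ (max r t)` of a path, starting at time `r`. -/
def pathTail : C(C(I, B) × I, C(I, B)) where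
  toFun q := ⟨fun t => q.1 (max q.2 t), by fun_prop⟩
  continuous_toFun := ContinuousMap.continuous_of_continuous_uncurry _ (by
    change Continuous fun x : (C(I, B) × I) × I => x.1.1 (max x.1.2 x.2)
    fun_prop)

/-- The reverse `t ↦ γ (min r (1 - t))` of the part of a path up to time `r`. -/
def pathBack : C(C(I, B) × I, C(I, B)) where
  toFun q := ⟨fun t => q.1 (min q.2 (σ t)), by fun_prop⟩
  continuous_toFun := ContinuousMap.continuous_of_continuous_uncurry _ (by
    change Continuous fun x : (C(I, B) × I) × I => x.1.1 (min x.1.2 (σ x.2))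
    fun_prop)

theorem pathTail_apply (γ : C(I, B)) (r t : I) : pathTail (γ, r) t = γ (max r t) := rfl

theorem pathBack_apply (γ : C(I, B)) (r t : I) : pathBack (γ, r) t = γ (min r (σ t)) := rfl

theorem pathTail_zero (γ : C(I, B)) : pathTail (γ, 0) = γ := by
  ext t; simp [pathTail_apply]

theorem pathTail_one (γ : C(I, B)) : pathTail (γ, 1) = ContinuousMap.const I (γ 1) := by
  ext t; simp [pathTail_apply, unitInterval.le_one']

theorem pathBack_zero (γ : C(I, B)) : pathBack (γ, 0) = ContinuousMap.const I (γ 0) := by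
  ext t; simp [pathBack_apply]

/-- A fibration has a continuous path lifting function. -/
theorem IsFibration.exists_lift (hp : IsFibration p) :
    ∃ L : C({q : E × C(I, B) // q.2 0 = p q.1} × I, E),
      (∀ q t, p (L (q, t)) = q.1.2 t) ∧ ∀ q, L (q, 0) = q.1.1 :=
  hp {q : E × C(I, B) // q.2 0 = p q.1} ⟨fun q => q.1.1, by fun_prop⟩
    ⟨fun x => x.1.1.2 x.2, by fun_prop⟩ fun q => q.2

theorem cyl_fibreLoop_homotopyEquiv_join (hp : IsFibration p) :
    Nonempty (ContinuousMap.HomotopyEquiv (Cyl (fibreLoop p b₀))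
      (Join (Fibre p b₀) (LoopS B b₀))) := by
  obtain ⟨L, hpL, hL0⟩ := hp.exists_lift
  have cF : Continuous (Subtype.val : Fibre p b₀ → E) := continuous_subtype_val
  have cW : Continuous (Subtype.val : LoopS B b₀ → C(I, B)) := continuous_subtype_val
  have cN : Continuous (Subtype.val : HoFib p b₀ → E × C(I, B)) := continuous_subtype_val
  let c : C(I, B) := ContinuousMap.const I b₀
  have hback : ∀ (γ : C(I, B)) r, pathBack (γ, r) 0 = γ r := fun γ r => by
    simp [pathBack_apply, unitInterval.le_one']
  have htail : ∀ (γ : C(I, B)) r, pathTail (γ, r) 0 = γ r := fun γ r => by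
    simp [pathTail_apply]
  have htail' : ∀ (γ : C(I, B)) r, pathTail (γ, r) 1 = γ 1 := fun γ r => by
    simp [pathTail_apply, unitInterval.le_one']
  let i : C(Fibre p b₀, HoFib p b₀) :=
    ⟨fun f => ⟨(f.1, c), f.2.symm, rfl⟩, Continuous.subtype_mk (by fun_prop) _⟩
  let τ : C(HoFib p b₀, Fibre p b₀) :=
    ⟨fun n => ⟨L (⟨n.1, n.2.1⟩, 1), (hpL _ _).trans n.2.2⟩,
      Continuous.subtype_mk (by fun_prop) _⟩
  let K : C(HoFib p b₀ × I, HoFib p b₀) :=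
    ⟨fun x => ⟨(L (⟨x.1.1, x.1.2.1⟩, x.2), pathTail (x.1.1.2, x.2)),
        (htail _ _).trans (hpL ⟨x.1.1, x.1.2.1⟩ x.2).symm, (htail' _ _).trans x.1.2.2⟩,
      Continuous.subtype_mk (by fun_prop) _⟩
  let k : C(Fibre p b₀ × I, Fibre p b₀) :=
    ⟨fun x => ⟨L (⟨(x.1.1, c), x.1.2.symm⟩, x.2), hpL _ _⟩,
      Continuous.subtype_mk (by fun_prop) _⟩
  let ψ : C(Fibre p b₀ × LoopS B b₀, Fibre p b₀) :=
    ⟨fun x => ⟨L (⟨(x.1.1, pathBack (x.2.1, 1)),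
        ((hback _ _).trans x.2.2.2).trans x.1.2.symm⟩, 1),
        (hpL _ _).trans (by simpa [pathBack_apply] using x.2.2.1)⟩,
      Continuous.subtype_mk (by fun_prop) _⟩
  let M : C(Fibre p b₀ × LoopS B b₀ × I, HoFib p b₀) :=
    ⟨fun x => ⟨(L (⟨(x.1.1, pathBack (x.2.1.1, 1)),
        ((hback _ _).trans x.2.1.2.2).trans x.1.2.symm⟩, x.2.2),
        pathTail (x.2.1.1, σ x.2.2)),
        (htail _ _).trans ((hpL _ _).trans (by simp [pathBack_apply, unitInterval.le_one'])).symm,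
        (htail' _ _).trans x.2.1.2.2⟩,
      Continuous.subtype_mk (by fun_prop) _⟩
  let A : C(Fibre p b₀ × LoopS B b₀ × I, {q : E × C(I, B) // q.2 0 = p q.1}) :=
    ⟨fun x => ⟨(L (⟨(x.1.1, x.2.1.1), x.2.1.2.1.trans x.1.2.symm⟩, x.2.2),
        pathBack (x.2.1.1, x.2.2)), (hback _ _).trans
          (hpL ⟨(x.1.1, x.2.1.1), x.2.1.2.1.trans x.1.2.symm⟩ x.2.2).symm⟩, by fun_prop⟩
  let β : C(Fibre p b₀ × LoopS B b₀ × I, Fibre p b₀) :=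
    ⟨fun x => ⟨L (A x, 1), (hpL _ _).trans (by
        simpa [A, pathBack_apply, unitInterval.nonneg'] using x.2.1.2.1)⟩,
      Continuous.subtype_mk (by fun_prop) _⟩
  let Q : C(Fibre p b₀ × LoopS B b₀ × I × I, HoFib p b₀) :=
    ⟨fun x => ⟨(L (A (x.1, x.2.1, x.2.2.1), x.2.2.2),
        pathTail (x.2.1.1, min x.2.2.1 (σ x.2.2.2))),
        (htail _ _).trans (hpL (A (x.1, x.2.1, x.2.2.1)) x.2.2.2).symm,
        (htail' _ _).trans x.2.1.2.2⟩,
      Continuous.subtype_mk (by fun_prop) _⟩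
  have hA0 : ∀ f w, A (f, w, 0) = ⟨(f.1, c), f.2.symm⟩ := fun f w =>
    Subtype.ext (Prod.ext (hL0 _)
      ((pathBack_zero _).trans (congrArg (ContinuousMap.const I) w.2.1)))
  refine cyl_homotopyEquiv_join (fibreLoop p b₀) i τ K k ψ M β Q ⟨c, rfl, rfl⟩
    (fun n => Subtype.ext (Prod.ext (hL0 _) (pathTail_zero _)))
    (fun n => Subtype.ext (Prod.ext rfl ?_))
    (fun f => Subtype.ext (hL0 _)) (fun f => rfl)
    (fun f w => Subtype.ext (Prod.ext (hL0 _) ?_))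
    (fun f w => Subtype.ext (Prod.ext rfl ?_))
    (fun f w r => Subtype.ext (Prod.ext (hL0 _) ?_))
    (fun f w r => Subtype.ext (Prod.ext rfl ?_))
    (fun f w s => Subtype.ext (Prod.ext rfl ?_))
    (fun f w => rfl)
    (fun f w s => Subtype.ext (Prod.ext ?_ ?_))
    (fun f w => Subtype.ext ?_)
  · exact (pathTail_one _).trans (congrArg (ContinuousMap.const I) n.2.2)
  · change pathTail (w.1, σ 0) = c
    rw [unitInterval.symm_zero, pathTail_one, w.2.2]
  · change pathTail (w.1, σ 1) = w.1
    rw [unitInterval.symm_one, pathTail_zero]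
  · change pathTail (w.1, min r (σ 0)) = pathTail (w.1, r)
    rw [unitInterval.symm_zero, min_eq_left unitInterval.le_one']
  · change pathTail (w.1, min r (σ 1)) = w.1
    rw [unitInterval.symm_one, min_eq_right unitInterval.nonneg', pathTail_zero]
  · change pathTail (w.1, min 1 (σ s)) = pathTail (w.1, σ s)
    rw [min_eq_right unitInterval.le_one']
  · exact congrArg (fun a => L (a, s)) (hA0 f w)
  · change pathTail (w.1, min 0 (σ s)) = w.1
    rw [min_eq_left unitInterval.nonneg', pathTail_zero]
  · exact congrArg (fun a => L (a, 1)) (hA0 f w)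

/-- The cone coordinate on `E ∪ CF`. -/
def coneHeight : C(FibreCofibre p b₀, I) where
  toFun := Quot.lift (Sum.elim Prod.snd fun _ => 1) (by rintro _ _ (_ | _) <;> rfl)
  continuous_toFun :=
    continuous_quot_lift _ (continuous_sum_dom.2 ⟨continuous_snd, continuous_const⟩)

/-- The retraction to `E` of the complement of the apex in `E ∪ CF`. -/
def conePoint (x : FibreCofibre p b₀) : E := Sum.elim (fun a => a.1.1) id x.out

theorem conePoint_mk (a : (Fibre p b₀ × I) ⊕ E) (h : 0 < coneHeight (p := p) (Quot.mk _ a)) :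
    conePoint (p := p) (b₀ := b₀) (Quot.mk _ a) = Sum.elim (fun a => a.1.1) id a := by
  classical
  let pt : FibreCofibre p b₀ → Option E :=
    Quot.lift (Sum.elim (fun a => if a.2 = 0 then none else some a.1.1) some) (by
      rintro _ _ (_ | _) <;> simp)
  have key : ∀ a : (Fibre p b₀ × I) ⊕ E, 0 < coneHeight (p := p) (Quot.mk _ a) →
      pt (Quot.mk _ a) = some (Sum.elim (fun a => a.1.1) id a) := by
    rintro (⟨f, s⟩ | e) h
    · exact if_neg h.ne'
    · rfl
  let x : FibreCofibre p b₀ := Quot.mk _ a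
  have hx : Quot.mk _ x.out = x := Quot.out_eq x
  have h' := key x.out (lt_of_lt_of_eq h (congrArg coneHeight hx.symm))
  exact (Option.some.inj ((key a h).symm.trans ((congrArg pt hx.symm).trans h'))).symm

theorem continuousOn_conePoint :
    ContinuousOn (conePoint (p := p) (b₀ := b₀)) {x | 0 < coneHeight x} := by
  have ho : IsOpen {x : FibreCofibre p b₀ | 0 < coneHeight x} :=
    isOpen_lt continuous_const coneHeight.continuous
  refine (continuousOn_open_iff ho).2 fun V hV => isQuotientMap_quot_mk.isOpen_preimage.1 ?_
  convert (ho.preimage continuous_quot_mk).inter (hV.preimage (continuous_sum_dom.2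
    ⟨(continuous_subtype_val.comp continuous_fst :
      Continuous fun a : Fibre p b₀ × I => a.1.1), continuous_id⟩ :
      Continuous (Sum.elim (fun a : Fibre p b₀ × I => a.1.1) (id : E → E)))) using 1
  ext a
  exact and_congr_right fun h => iff_of_eq (congrArg (· ∈ V) (conePoint_mk a h))

/-- The map that stretches the cone coordinate, collapsing its values near the ends. -/
def stretch (u s : ℝ) : I := clamp (s + u * (2 * s - 1))

theorem stretch_zero_left (s : I) : stretch 0 s = s := by simp [stretch]

theorem stretch_zero_right (u : I) : stretch u 0 = 0 :=
  clamp_of_le_zero (by linarith [u.2.1])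

theorem stretch_one_right (u : I) : stretch u 1 = 1 :=
  clamp_of_one_le (by linarith [u.2.1])

/-- The map from the homotopy fibre of `E ∪ CF → B` to the double mapping cylinder that stretches
the cone coordinate, which makes it continuous although the cone has the quotient topology. -/
def toCyl (x : FibreCofibre p b₀) : ∀ γ : C(I, B), γ 0 = fibreCofibreMap p b₀ x → γ 1 = b₀ →
    Cyl (fibreLoop p b₀) :=
  Quot.hrecOn (motive := fun x => ∀ γ : C(I, B), γ 0 = fibreCofibreMap p b₀ x → γ 1 = b₀ →
      Cyl (fibreLoop p b₀)) x
    (fun a => match a with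
      | Sum.inl (f, s) => fun γ h h' => Cyl.inl (fibreLoop p b₀) (f, ⟨γ, h, h'⟩, stretch 1 s)
      | Sum.inr e => fun γ h h' => Cyl.inr (fibreLoop p b₀) ⟨(e, γ), h, h'⟩)
    (by
      intro a b hab
      refine Function.hfunext rfl fun γ γ' hγ => ?_
      obtain rfl := eq_of_heq hγ
      refine Function.hfunext (by rw [Quot.sound hab]) fun h h' _ => ?_
      refine Function.hfunext rfl fun g _ _ => heq_of_eq ?_
      cases hab with
      | glue f =>
        simp only [Set.Icc.coe_one]
        rw [show stretch 1 1 = 1 from stretch_one_right 1]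
        exact Cyl.inl_one (fibreLoop p b₀) f ⟨γ, h, g⟩
      | apex f f' =>
        simp only [Set.Icc.coe_zero]
        rw [show stretch 1 0 = 0 from stretch_zero_right 1]
        exact Cyl.inl_zero _ _ _ _)

theorem continuous_toCyl : Continuous fun q : HoFib (fibreCofibreMap p b₀) b₀ =>
    toCyl q.1.1 q.1.2 q.2.1 q.2.2 := by
  have cX : Continuous (Subtype.val : HoFib (fibreCofibreMap p b₀) b₀ → _) :=
    continuous_subtype_val
  have cs : Continuous fun q : HoFib (fibreCofibreMap p b₀) b₀ => (coneHeight q.1.1 : ℝ) := by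
    fun_prop
  have ce : ContinuousOn (fun q : HoFib (fibreCofibreMap p b₀) b₀ => conePoint q.1.1)
      {q | 0 < (coneHeight q.1.1 : ℝ)} :=
    continuousOn_conePoint.comp (by fun_prop) fun _ h => h
  have local_eq : ∀ (s : Set (HoFib (fibreCofibreMap p b₀) b₀)) (g : s → Cyl (fibreLoop p b₀)),
      IsOpen s → Continuous g → (∀ q : s, toCyl q.1.1.1 q.1.1.2 q.1.2.1 q.1.2.2 = g q) →
      ∀ q ∈ s, ContinuousAt (fun q : HoFib (fibreCofibreMap p b₀) b₀ =>
        toCyl q.1.1 q.1.2 q.2.1 q.2.2) q := by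
    intro s g hs hg h q hq
    refine ContinuousOn.continuousAt (s := s) ?_ (hs.mem_nhds hq)
    rw [continuousOn_iff_continuous_domRestrict]
    exact hg.congr fun q => (h q).symm
  rw [continuous_iff_continuousAt]
  intro q
  rcases lt_or_ge (coneHeight q.1.1 : ℝ) (1 / 3) with h | h
  · have hne : ∀ x : FibreCofibre p b₀, (coneHeight x : ℝ) < 1 / 3 → Nonempty (Fibre p b₀) := by
      rintro ⟨⟨f, s⟩ | e⟩ h
      · exact ⟨f⟩
      · change (1 : ℝ) < 1 / 3 at h
        norm_num at h
    obtain ⟨f⟩ := hne _ h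
    have hloop : ∀ q : HoFib (fibreCofibreMap p b₀) b₀, (coneHeight q.1.1 : ℝ) < 1 / 3 →
        q.1.2 0 = b₀ := by
      rintro ⟨⟨⟨⟨f, s⟩ | e⟩, γ⟩, h1, h2⟩ h
      · exact h1
      · change (1 : ℝ) < 1 / 3 at h
        norm_num at h
    refine local_eq {q | (coneHeight q.1.1 : ℝ) < 1 / 3}
      (fun q => Cyl.inl _ (f, ⟨q.1.1.2, hloop q.1 q.2, q.1.2.2⟩, 0))
      (isOpen_lt cs continuous_const) ?_ ?_ q h
    · refine (Cyl.continuous_inl _).comp (continuous_const.prodMk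
        (Continuous.prodMk (Continuous.subtype_mk (by fun_prop) _) continuous_const))
    · rintro ⟨⟨⟨⟨⟨f', s⟩ | e⟩, γ⟩, h1, h2⟩, h⟩
      · change Cyl.inl _ (f', _, stretch 1 s) = _
        rw [stretch, clamp_of_le_zero]
        · exact Cyl.inl_zero _ _ _ _
        · change (s : ℝ) < 1 / 3 at h
          linarith
      · change (1 : ℝ) < 1 / 3 at h
        norm_num at h
  rcases lt_or_ge (2 / 3) (coneHeight q.1.1 : ℝ) with h' | h'
  · have hpt : ∀ q : HoFib (fibreCofibreMap p b₀) b₀, 2 / 3 < (coneHeight q.1.1 : ℝ) →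
        q.1.2 0 = p (conePoint q.1.1) := by
      rintro ⟨⟨⟨a⟩, γ⟩, h1, h2⟩ h
      have ha := conePoint_mk a (show (0 : ℝ) < _ by linarith)
      simp only at h1 ⊢
      rw [h1, ha]
      rcases a with ⟨f, s⟩ | e
      · exact f.2.symm
      · rfl
    have hsub : {q : HoFib (fibreCofibreMap p b₀) b₀ | 2 / 3 < (coneHeight q.1.1 : ℝ)} ⊆
        {q | 0 < (coneHeight q.1.1 : ℝ)} := fun q hq => lt_trans (by norm_num : (0 : ℝ) < 2 / 3) hq
    refine local_eq {q | 2 / 3 < (coneHeight q.1.1 : ℝ)}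
      (fun q => Cyl.inr _ ⟨(conePoint q.1.1.1, q.1.1.2), hpt q.1 q.2, q.1.2.2⟩)
      (isOpen_lt continuous_const cs) ?_ ?_ q h'
    · refine (Cyl.continuous_inr _).comp (Continuous.subtype_mk (Continuous.prodMk
        (continuousOn_iff_continuous_domRestrict.1
          (ce.mono hsub)) (continuous_snd.comp (cX.comp continuous_subtype_val))) _)
    · rintro ⟨⟨⟨⟨a⟩, γ⟩, h1, h2⟩, h⟩
      have ha := conePoint_mk a (show (0 : ℝ) < _ by
        change 2 / 3 < (coneHeight _ : ℝ) at h
        linarith)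
      rcases a with ⟨f, s⟩ | e
      · change Cyl.inl _ (f, _, stretch 1 s) = _
        rw [stretch, clamp_of_one_le]
        · exact (Cyl.inl_one (fibreLoop p b₀) f _).trans
            (congrArg _ (Subtype.ext (Prod.ext ha.symm rfl)))
        · change 2 / 3 < (s : ℝ) at h
          linarith
      · exact congrArg (Cyl.inr _) (Subtype.ext (Prod.ext ha.symm rfl))
  · have hmid : ∀ q : HoFib (fibreCofibreMap p b₀) b₀, 0 < (coneHeight q.1.1 : ℝ) →
        (coneHeight q.1.1 : ℝ) < 1 → p (conePoint q.1.1) = b₀ ∧ q.1.2 0 = b₀ := by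
      rintro ⟨⟨⟨a⟩, γ⟩, h1, h2⟩ h h'
      have ha := conePoint_mk a h
      rcases a with ⟨f, s⟩ | e
      · exact ⟨(congrArg p ha).trans f.2, h1⟩
      · exact absurd h' (lt_irrefl _)
    refine local_eq {q | 0 < (coneHeight q.1.1 : ℝ) ∧ (coneHeight q.1.1 : ℝ) < 1}
      (fun q => Cyl.inl _ (⟨conePoint q.1.1.1, (hmid q.1 q.2.1 q.2.2).1⟩,
        ⟨q.1.1.2, (hmid q.1 q.2.1 q.2.2).2, q.1.2.2⟩, stretch 1 (coneHeight q.1.1.1)))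
      ((isOpen_lt continuous_const cs).inter (isOpen_lt cs continuous_const)) ?_ ?_ q
      ⟨by linarith, by linarith⟩
    · refine (Cyl.continuous_inl _).comp (Continuous.prodMk (Continuous.subtype_mk
        (continuousOn_iff_continuous_domRestrict.1 (ce.mono fun q hq => hq.1)) _)
        (Continuous.prodMk (Continuous.subtype_mk (by fun_prop) _) ?_))
      unfold stretch
      fun_prop
    · rintro ⟨⟨⟨⟨a⟩, γ⟩, h1, h2⟩, h, h'⟩
      have ha := conePoint_mk a h
      rcases a with ⟨f, s⟩ | e
      · exact congrArg (fun f' => Cyl.inl (fibreLoop p b₀) (f', _, stretch 1 s))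
          (Subtype.ext ha.symm)
      · exact absurd h' (lt_irrefl _)

theorem hofib_homotopyEquiv_cyl :
    Nonempty (ContinuousMap.HomotopyEquiv (HoFib (fibreCofibreMap p b₀) b₀)
      (Cyl (fibreLoop p b₀))) := by
  have cX : Continuous (Subtype.val : HoFib (fibreCofibreMap p b₀) b₀ → _) :=
    continuous_subtype_val
  have cF : Continuous (Subtype.val : Fibre p b₀ → E) := continuous_subtype_val
  have cW : Continuous (Subtype.val : LoopS B b₀ → C(I, B)) := continuous_subtype_val
  have cN : Continuous (Subtype.val : HoFib p b₀ → E × C(I, B)) := continuous_subtype_val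
  let R : C(HoFib (fibreCofibreMap p b₀) b₀, Cyl (fibreLoop p b₀)) := ⟨_, continuous_toCyl⟩
  let S : C(Cyl (fibreLoop p b₀), HoFib (fibreCofibreMap p b₀) b₀) :=
    ⟨Quot.lift (Sum.elim
        (fun x => ⟨(Quot.mk _ (Sum.inl (x.1, x.2.2)), x.2.1.1), x.2.1.2⟩)
        (fun n => ⟨(Quot.mk _ (Sum.inr n.1.1), n.1.2), n.2⟩)) (by
          rintro _ _ (⟨f, w⟩ | ⟨f, f', w⟩)
          · exact Subtype.ext (Prod.ext (Quot.sound (.glue f)) rfl)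
          · exact Subtype.ext (Prod.ext (Quot.sound (.apex f f')) rfl)),
      continuous_quot_lift _ (continuous_sum_dom.2
        ⟨Continuous.subtype_mk ((continuous_quot_mk.comp (by fun_prop)).prodMk (by fun_prop)) _,
         Continuous.subtype_mk ((continuous_quot_mk.comp (by fun_prop)).prodMk (by fun_prop)) _⟩)⟩
  let D : FibreCofibre p b₀ × I → FibreCofibre p b₀ := fun q =>
    Quot.lift (Sum.elim (fun a => Quot.mk _ (Sum.inl (a.1, stretch q.2 a.2)))
      (fun e => Quot.mk _ (Sum.inr e))) (by
        rintro _ _ (f | ⟨f, f'⟩)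
        · simpa [stretch_one_right] using Quot.sound (.glue f)
        · simpa [stretch_zero_right] using Quot.sound (.apex f f')) q.1
  have cD : Continuous D := by
    refine isQuotientMap_quot_mk.continuous_lift_prod_left (continuous_sum_prod ?_ ?_)
    · refine continuous_quot_mk.comp ?_
      simp only [stretch]
      fun_prop
    · exact continuous_quot_mk.comp (by fun_prop)
  have hD : ∀ q, fibreCofibreMap p b₀ (D q) = fibreCofibreMap p b₀ q.1 := by
    rintro ⟨⟨⟨f, s⟩ | e⟩, u⟩ <;> rfl
  have hD0 : ∀ x, D (x, 0) = x := by
    rintro ⟨⟨f, s⟩ | e⟩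
    · exact congrArg (fun s => Quot.mk _ (Sum.inl (f, s))) (stretch_zero_left s)
    · rfl
  have hSR : ((ContinuousMap.id _).Homotopic (S.comp R)) :=
    ⟨{ toFun := fun q => ⟨(D (q.2.1.1, q.1), q.2.1.2), q.2.2.1.trans (hD (q.2.1.1, q.1)).symm, q.2.2.2⟩
       continuous_toFun := Continuous.subtype_mk ((cD.comp (by fun_prop)).prodMk (by fun_prop)) _
       map_zero_left := fun q => Subtype.ext (Prod.ext (hD0 _) rfl)
       map_one_left := by rintro ⟨⟨⟨⟨f, s⟩ | e⟩, γ⟩, h⟩ <;> rfl }⟩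
  have hRS : ((ContinuousMap.id _).Homotopic (R.comp S)) := by
    refine homotopic_of_quot (fun q => Sum.elim (fun x => Cyl.inl (fibreLoop p b₀)
      (x.1, x.2.1, stretch q.2 x.2.2)) (Cyl.inr _) q.1) ?_ ?_ ?_ ?_
    · simp only [stretch]
      exact continuous_sum_prod (by simp only [Sum.elim_inl]; fun_prop)
        (by simp only [Sum.elim_inr]; fun_prop)
    · rintro _ _ (⟨f, w⟩ | ⟨f, f', w⟩) t
      · simpa [stretch_one_right] using Cyl.inl_one _ _ _
      · simpa [stretch_zero_right] using Cyl.inl_zero _ _ _ _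
    · rintro (⟨f, w, s⟩ | n)
      · simp [stretch_zero_left]; rfl
      · rfl
    · rintro (⟨f, w, s⟩ | n) <;> rfl
  exact ⟨⟨R, S, hSR.symm, hRS.symm⟩⟩

end Ganea

/-- Ganea's theorem (fibre–cofibre construction): for a fibration `p : E → B` over a
path-connected base, the homotopy fibre of the induced map `φ : E ∪ CF → B` is homotopy
equivalent to the join `F * ΩB`. -/
theorem hofib_fibreCofibre_homotopyEquiv_join [PathConnectedSpace B]
    (p : C(E, B)) (hp : IsFibration p) (b0 : B) :
    Nonempty (ContinuousMap.HomotopyEquiv (HoFib (fibreCofibreMap p b0) b0)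
      (Join (Fibre p b0) (LoopS B b0))) := by
  obtain ⟨e⟩ := hofib_homotopyEquiv_cyl (p := p) (b₀ := b0)
  obtain ⟨e'⟩ := cyl_fibreLoop_homotopyEquiv_join (b₀ := b0) hp
  exact ⟨e.trans e'⟩
end
end
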